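/- arXiv:math/9903200 — 2 statements merged into one kernel-verified Lean document; each statement's English description precedes it below -/
import Mathlib

section
/- Let n ≥ 2 be an even integer and let K be an origin-symmetric star body in ℝⁿ with C^∞ boundary. Then K is an intersection body if and only if (−1)^{(n−2)/2} A_ξ^{(n−2)}(0) ≥ 0 for every ξ ∈ S^{n−1}, where A_ξ^{(n−2)}(0) is the (n−2)-nd derivative at 0 of the parallel section function z ↦ A_ξ(z). -/
open MeasureTheory Set
open scoped RealInnerProductSpace ENNReal


namespace IB
open Metric

theorem polar_gen {V : Type*} [NormedAddCommGroup V] [NormedSpace ℝ V] [MeasurableSpace V]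
    [BorelSpace V] [FiniteDimensional ℝ V] [Nontrivial V] (μ : Measure V) [μ.IsAddHaarMeasure]
    {G : Type*} [NormedAddCommGroup G] [NormedSpace ℝ G]
    (f : V → G) :
    ∫ x, f x ∂μ = ∫ p : sphere (0:V) 1 × Ioi (0:ℝ), f (p.2.1 • p.1.1)
      ∂(μ.toSphere.prod (Measure.volumeIoiPow (Module.finrank ℝ V - 1))) := by
  have := μ.measurePreserving_homeomorphUnitSphereProd.integral_comp
    (Homeomorph.measurableEmbedding _) (fun p : sphere (0:V) 1 × Ioi (0:ℝ) => f (p.2.1 • p.1.1))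
  rw [← this, ← restrict_compl_singleton (μ := μ) 0, ← integral_subtype_comap
    (measurableSet_singleton _).compl (μ := μ) f]
  rw [restrict_compl_singleton]
  refine integral_congr_ae (Filter.Eventually.of_forall fun x => ?_)
  have hx : (x:V) ≠ 0 := x.2
  have hx' : ‖(x:V)‖ ≠ 0 := norm_ne_zero_iff.2 hx
  simp [smul_smul, hx']

theorem integral_volumeIoiPow {G : Type*} [NormedAddCommGroup G] [NormedSpace ℝ G] (n : ℕ)
    (f : ℝ → G) : ∫ r : Ioi (0:ℝ), f r.1 ∂(Measure.volumeIoiPow n) =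
      ∫ r in Ioi (0:ℝ), r ^ n • f r := by
  rw [Measure.volumeIoiPow, integral_withDensity_eq_integral_toReal_smul (by fun_prop)
    (Filter.Eventually.of_forall fun _ => ENNReal.ofReal_lt_top),
    integral_subtype_comap measurableSet_Ioi (fun r : ℝ => (ENNReal.ofReal (r ^ n)).toReal • f r)]
  refine setIntegral_congr_fun measurableSet_Ioi fun r hr => ?_
  have : 0 ≤ r ^ n := pow_nonneg (le_of_lt hr) _
  simp [ENNReal.toReal_ofReal this]

theorem polar_mul {V : Type*} [NormedAddCommGroup V] [NormedSpace ℝ V] [MeasurableSpace V]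
    [BorelSpace V] [FiniteDimensional ℝ V] [Nontrivial V] (μ : Measure V) [μ.IsAddHaarMeasure]
    (h : ℝ → ℝ) (f : V → ℝ) :
    ∫ x, h ‖x‖ * f (‖x‖⁻¹ • x) ∂μ =
      (∫ r in Ioi (0:ℝ), r ^ (Module.finrank ℝ V - 1) * h r) *
        ∫ x : sphere (0:V) 1, f x ∂μ.toSphere := by
  have e := (integral_volumeIoiPow (Module.finrank ℝ V - 1) h).symm
  simp only [smul_eq_mul] at e
  rw [polar_gen μ, e, mul_comm, ← integral_prod_mul]
  refine integral_congr_ae (Filter.Eventually.of_forall fun p => ?_)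
  have h2 : (0:ℝ) < p.2.1 := p.2.2
  have h1 : ‖p.1.1‖ = 1 := by simpa using p.1.2
  simp [norm_smul, h1, abs_of_pos h2, smul_smul, h2.ne', mul_comm]

theorem polar_int {V : Type*} [NormedAddCommGroup V] [NormedSpace ℝ V] [MeasurableSpace V]
    [BorelSpace V] [FiniteDimensional ℝ V] [Nontrivial V] (μ : Measure V) [μ.IsAddHaarMeasure]
    {G : Type*} [NormedAddCommGroup G] [NormedSpace ℝ G]
    (f : V → G) (hf : Integrable f μ) :
    Integrable (fun θ : sphere (0:V) 1 => ∫ r in Ioi (0:ℝ),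
      r ^ (Module.finrank ℝ V - 1) • f (r • θ.1)) μ.toSphere ∧
    ∫ x, f x ∂μ = ∫ θ : sphere (0:V) 1, (∫ r in Ioi (0:ℝ),
      r ^ (Module.finrank ℝ V - 1) • f (r • θ.1)) ∂μ.toSphere := by
  have key : Integrable (fun p : sphere (0:V) 1 × Ioi (0:ℝ) => f (p.2.1 • p.1.1))
      (μ.toSphere.prod (Measure.volumeIoiPow (Module.finrank ℝ V - 1))) := by
    rw [← μ.measurePreserving_homeomorphUnitSphereProd.integrable_comp_emb
      (Homeomorph.measurableEmbedding _)]
    have h2 : Integrable (fun x : ({0}ᶜ : Set V) => f x) (μ.comap (↑)) := by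
      exact (integrableOn_iff_comap_subtypeVal (measurableSet_singleton _).compl).1
        hf.integrableOn
    refine h2.congr (Filter.Eventually.of_forall fun x => ?_)
    have hx : (x:V) ≠ 0 := x.2
    have hx' : ‖(x:V)‖ ≠ 0 := norm_ne_zero_iff.2 hx
    simp [smul_smul, hx']
  have e : ∀ θ : sphere (0:V) 1, ∫ r in Ioi (0:ℝ), r ^ (Module.finrank ℝ V - 1) • f (r • θ.1)
    = ∫ r : Ioi (0:ℝ), f (r.1 • θ.1) ∂(Measure.volumeIoiPow (Module.finrank ℝ V - 1)) :=
    fun θ => (integral_volumeIoiPow _ (fun r => f (r • θ.1))).symm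
  simp only [e]
  refine ⟨key.integral_prod_left, ?_⟩
  rw [polar_gen μ, integral_prod _ key]

/-- uniqueness of uniformly distributed measures -/
theorem unif_unique {X : Type*} [PseudoMetricSpace X] [CompactSpace X] [MeasurableSpace X]
    [BorelSpace X] [SecondCountableTopology X]
    (μ ν : Measure X) [IsFiniteMeasure μ] [IsFiniteMeasure ν]
    (hμ : ∀ x y r, μ (closedBall x r) = μ (closedBall y r))
    (hν : ∀ x y r, ν (closedBall x r) = ν (closedBall y r))
    (hpos : ∀ x r, 0 < r → 0 < ν (closedBall x r)) (f : X → ℝ) (hf : Continuous f) :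
    ν.real univ * ∫ x, f x ∂μ = μ.real univ * ∫ x, f x ∂ν := by
  rcases isEmpty_or_nonempty X with hX | ⟨⟨x0⟩⟩
  · simp [Measure.real, Measure.eq_zero_of_isEmpty]
  -- bounded
  obtain ⟨C, hC⟩ : ∃ C, ∀ x, ‖f x‖ ≤ C := by
    obtain ⟨C, hC⟩ := (isCompact_univ (X := X)).exists_bound_of_continuousOn hf.continuousOn
    exact ⟨C, fun x => hC x (mem_univ x)⟩
  have fint : ∀ m : Measure X, IsFiniteMeasure m → Integrable f m := fun m _ =>
    Integrable.of_bound hf.aestronglyMeasurable C (Filter.Eventually.of_forall hC)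
  have meas : ∀ r : ℝ, MeasurableSet {p : X × X | dist p.1 p.2 ≤ r} := fun r =>
    (isClosed_le continuous_dist continuous_const).measurableSet
  -- Fubini
  have fub : ∀ r, ∫ x, (∫ y in closedBall x r, f y ∂ν) ∂μ
      = μ.real (closedBall x0 r) * ∫ y, f y ∂ν := by
    intro r
    have h1 : ∀ x, ∫ y in closedBall x r, f y ∂ν =
        ∫ y, ({p : X × X | dist p.1 p.2 ≤ r}.indicator (fun p => f p.2)) (x, y) ∂ν := by
      intro x
      rw [← integral_indicator isClosed_closedBall.measurableSet]
      refine integral_congr_ae (Filter.Eventually.of_forall fun y => ?_)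
      simp [indicator, dist_comm]
    simp only [h1]
    rw [integral_integral_swap]
    · rw [← integral_const_mul]
      refine integral_congr_ae (Filter.Eventually.of_forall fun y => ?_)
      have : (fun x => ({p : X × X | dist p.1 p.2 ≤ r}.indicator (fun p => f p.2)) (x, y))
          = (closedBall y r).indicator (fun _ => f y) := by
        funext x; simp [indicator]
      simp only [this]
      rw [integral_indicator isClosed_closedBall.measurableSet, setIntegral_const]
      simp [Measure.real, hμ y x0]
    · refine Integrable.of_bound (C := C) ?_ (Filter.Eventually.of_forall fun p => ?_)
      · exact ((hf.comp continuous_snd).measurable.indicator (meas r)).aestronglyMeasurable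
      · simp only [Function.uncurry, indicator]
        split_ifs
        · exact hC _
        · simpa using (norm_nonneg _).trans (hC x0)
  have fub1 : ∀ r, μ.real univ * ν.real (closedBall x0 r) =
      μ.real (closedBall x0 r) * ν.real univ := by
    intro r
    have h1 : ∀ y : X, μ.real (closedBall y r) = μ.real (closedBall x0 r) := fun y => by
      simp [Measure.real, hμ y x0]
    have h2 : ∀ y : X, ν.real (closedBall y r) = ν.real (closedBall x0 r) := fun y => by
      simp [Measure.real, hν y x0]
    have e1 : (μ.prod ν) {p : X × X | dist p.1 p.2 ≤ r} = ν (closedBall x0 r) * μ univ := by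
      rw [Measure.prod_apply (meas r)]
      have : ∀ x, ν (Prod.mk x ⁻¹' {p : X × X | dist p.1 p.2 ≤ r}) = ν (closedBall x0 r) := by
        intro x; rw [← hν x x0]; congr 1; ext y; simp [dist_comm]
      simp only [this, lintegral_const]
    have e2 : (μ.prod ν) {p : X × X | dist p.1 p.2 ≤ r} = μ (closedBall x0 r) * ν univ := by
      rw [Measure.prod_apply_symm (meas r)]
      have : ∀ y, μ ((fun x => (x, y)) ⁻¹' {p : X × X | dist p.1 p.2 ≤ r}) = μ (closedBall x0 r) := by
        intro x; rw [← hμ x x0]; congr 1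
      simp only [this, lintegral_const]
    rw [e1] at e2
    have := congrArg ENNReal.toReal e2
    simp only [ENNReal.toReal_mul] at this
    simp only [Measure.real]; linarith
  have huc : UniformContinuous f := CompactSpace.uniformContinuous_of_continuous hf
  -- final estimate
  have est : ∀ ε > 0, |ν.real univ * ∫ x, f x ∂μ - μ.real univ * ∫ x, f x ∂ν| ≤
      ε * (μ.real univ * ν.real univ) := by
    intro ε hε
    obtain ⟨δ, hδ, hd⟩ := Metric.uniformContinuous_iff.1 huc ε hε
    set r := δ / 2
    have hr : 0 < r := half_pos hδ
    set c := ν.real (closedBall x0 r) with hc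
    have hcpos : 0 < c := ENNReal.toReal_pos (hpos x0 r hr).ne' (measure_ne_top _ _)
    have h2 : ∀ y : X, ν.real (closedBall y r) = c := fun y => by
      simp [hc, Measure.real, hν y x0]
    have h3 : ∀ x, ‖c * f x - ∫ y in closedBall x r, f y ∂ν‖ ≤ ε * c := by
      intro x
      have : c * f x - ∫ y in closedBall x r, f y ∂ν = ∫ y in closedBall x r, (f x - f y) ∂ν := by
        rw [integral_sub (integrable_const _) (fint ν inferInstance).integrableOn, setIntegral_const,
          h2, smul_eq_mul]
      rw [this, ← h2 x]
      refine norm_setIntegral_le_of_norm_le_const (measure_lt_top _ _) fun y hy => ?_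
      rw [← dist_eq_norm]
      refine (hd ?_).le
      rw [dist_comm]
      exact (mem_closedBall.1 hy).trans_lt (half_lt_self hδ)
    have h4 : Integrable (fun x => ∫ y in closedBall x r, f y ∂ν) μ := by
      by_contra hcon
      -- measurability via Fubini
      have h1 : ∀ x, ∫ y in closedBall x r, f y ∂ν =
        ∫ y, ({p : X × X | dist p.1 p.2 ≤ r}.indicator (fun p => f p.2)) (x, y) ∂ν := by
        intro x
        rw [← integral_indicator isClosed_closedBall.measurableSet]
        refine integral_congr_ae (Filter.Eventually.of_forall fun y => ?_)
        simp [indicator, dist_comm]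
      apply hcon
      simp only [h1]
      refine Integrable.integral_prod_left (μ := μ) (ν := ν) (f := ({p : X × X | dist p.1 p.2 ≤ r}.indicator (fun p => f p.2))) ?_
      refine Integrable.of_bound (C := C) ?_ (Filter.Eventually.of_forall fun p => ?_)
      · exact ((hf.comp continuous_snd).measurable.indicator (meas r)).aestronglyMeasurable
      · simp only [indicator]
        split_ifs
        · exact hC _
        · simpa using (norm_nonneg _).trans (hC x0)
    have h5 : ‖∫ x, (c * f x - ∫ y in closedBall x r, f y ∂ν) ∂μ‖ ≤ ε * c * μ.real univ :=
      norm_integral_le_of_norm_le_const (Filter.Eventually.of_forall h3)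
    rw [integral_sub ((fint μ inferInstance).const_mul c) h4, integral_const_mul, fub r] at h5
    have h6 := fub1 r
    set b := μ.real (closedBall x0 r)
    have h7 : |c * ∫ x, f x ∂μ - b * ∫ y, f y ∂ν| * ν.real univ ≤ ε * c * μ.real univ * ν.real univ :=
      mul_le_mul_of_nonneg_right h5 measureReal_nonneg
    rw [← abs_of_nonneg (measureReal_nonneg (μ := ν) (s := univ)), ← abs_mul,
      abs_of_nonneg (measureReal_nonneg (μ := ν) (s := univ))] at h7
    have h8 : (c * ∫ x, f x ∂μ - b * ∫ y, f y ∂ν) * ν.real univ =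
      c * (ν.real univ * ∫ x, f x ∂μ - μ.real univ * ∫ x, f x ∂ν) := by
      linear_combination (∫ y, f y ∂ν) * h6
    rw [h8, abs_mul, abs_of_pos hcpos] at h7
    refine le_of_mul_le_mul_left (h7.trans_eq ?_) hcpos
    ring
  have : |ν.real univ * ∫ x, f x ∂μ - μ.real univ * ∫ x, f x ∂ν| ≤ 0 := by
    refine le_of_forall_pos_le_add fun ε hε => ?_
    set M := μ.real univ * ν.real univ
    have hM : 0 ≤ M := by positivity
    refine (est (ε / (M + 1)) (by positivity)).trans ?_
    rw [zero_add, div_mul_eq_mul_div, div_le_iff₀ (by positivity)]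
    nlinarith
  linarith [abs_nonpos_iff.1 this]

end IB


set_option linter.unusedSectionVars false

namespace IB
open Metric
open scoped Pointwise

section sph
variable {V : Type*} [NormedAddCommGroup V] [InnerProductSpace ℝ V] [MeasurableSpace V]
    [BorelSpace V] [FiniteDimensional ℝ V]

theorem exists_rot (x y : V) (h : ‖x‖ = ‖y‖) : ∃ T : V ≃ₗᵢ[ℝ] V, T x = y :=
  ⟨_, Submodule.reflection_sub h⟩

theorem rot_cap (T : V ≃ₗᵢ[ℝ] V) (x : V) (r : ℝ) :
    T '' (closedBall x r ∩ sphere 0 1) = closedBall (T x) r ∩ sphere 0 1 := by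
  rw [image_inter T.injective]
  congr 1
  · exact T.toIsometryEquiv.image_closedBall x r
  · simpa using T.toIsometryEquiv.image_sphere 0 1

theorem coe_cap (x : sphere (0:V) 1) (r : ℝ) :
    ((↑) '' (closedBall x r) : Set V) = closedBall x.1 r ∩ sphere 0 1 := by
  ext y; constructor
  · rintro ⟨z, hz, rfl⟩; exact ⟨hz, z.2⟩
  · rintro ⟨h1, h2⟩; exact ⟨⟨y, h2⟩, h1, rfl⟩

theorem muS_ball (d : ℝ) (x y : sphere (0:V) 1) (r : ℝ) :
    (μH[d].comap (Subtype.val : sphere (0:V) 1 → V)) (closedBall x r) =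
    (μH[d].comap (Subtype.val : sphere (0:V) 1 → V)) (closedBall y r) := by
  have hs : MeasurableSet (sphere (0:V) 1) := isClosed_sphere.measurableSet
  obtain ⟨T, hT⟩ := exists_rot x.1 y.1 (by simp)
  rw [comap_subtype_coe_apply hs, comap_subtype_coe_apply hs, coe_cap, coe_cap, ← hT,
    ← rot_cap, ]
  exact (T.toIsometryEquiv.hausdorffMeasure_image d _).symm

theorem sigma_ball (x y : sphere (0:V) 1) (r : ℝ) :
    (volume : Measure V).toSphere (closedBall x r) =
    (volume : Measure V).toSphere (closedBall y r) := by
  obtain ⟨T, hT⟩ := exists_rot x.1 y.1 (by simp)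
  rw [Measure.toSphere_apply' _ isClosed_closedBall.measurableSet,
    Measure.toSphere_apply' _ isClosed_closedBall.measurableSet, coe_cap, coe_cap, ← hT,
    ← rot_cap]
  congr 1
  have : Ioo (0:ℝ) 1 • (T '' (closedBall x.1 r ∩ sphere 0 1)) =
      T '' (Ioo (0:ℝ) 1 • (closedBall x.1 r ∩ sphere 0 1)) := by
    rw [← image2_smul, ← image2_smul, image_image2, image2_image_right]
    simp
  rw [this]
  have h2 := T.symm.measurePreserving.measure_preimage_equiv (f := T.symm.toHomeomorph.toMeasurableEquiv)
    (Ioo (0:ℝ) 1 • (closedBall x.1 r ∩ sphere 0 1))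
  rw [← h2]
  congr 1
  ext z
  constructor
  · intro hz
    exact ⟨T.symm z, hz, by simp⟩
  · rintro ⟨w, hw, rfl⟩
    simpa using hw

theorem muS_finite (j : ℕ) (hj : Module.finrank ℝ V = j + 1) :
    μH[(j:ℝ)] (sphere (0:V) 1) < ∞ := by
  refine (isCompact_sphere (0:V) 1).measure_lt_top_of_nhdsWithin fun u hu => ?_
  have hu1 : ‖u‖ = 1 := by simpa using hu
  have hu0 : u ≠ 0 := fun h => by simp [h] at hu1
  have : Fact (Module.finrank ℝ V = j + 1) := ⟨hj⟩
  have hW : Module.finrank ℝ (ℝ ∙ u)ᗮ = j := Submodule.finrank_orthogonal_span_singleton hu0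
  let γ : (ℝ ∙ u)ᗮ → V := fun y => ‖u + y.1‖⁻¹ • (u + y.1)
  have hγ : ContDiffAt ℝ 1 γ 0 := by
    have h0 : ContDiffAt ℝ 1 (fun y : (ℝ ∙ u)ᗮ => u + y.1) 0 :=
      contDiffAt_const.add ((ℝ ∙ u)ᗮ.subtypeL.contDiff.contDiffAt)
    have h1 : u + ((0 : (ℝ ∙ u)ᗮ) : V) ≠ 0 := by simpa using hu0
    exact ((h0.norm ℝ h1).inv (norm_ne_zero_iff.2 h1)).smul h0
  obtain ⟨K, t, ht, hL⟩ := hγ.exists_lipschitzOnWith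
  have ht2 : t ∩ ball 0 1 ∈ nhds (0 : (ℝ ∙ u)ᗮ) := Filter.inter_mem ht (ball_mem_nhds _ one_pos)
  set t' := t ∩ ball (0 : (ℝ ∙ u)ᗮ) 1
  have hfin : μH[(j:ℝ)] (γ '' t') < ∞ := by
    refine ((hL.mono inter_subset_left).hausdorffMeasure_image_le (by positivity)).trans_lt ?_
    refine ENNReal.mul_lt_top (ENNReal.rpow_lt_top_of_nonneg (by positivity) ENNReal.coe_ne_top) ?_
    refine (measure_mono inter_subset_right).trans_lt ?_
    rw [← hW]
    exact measure_ball_lt_top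
  have hmaps : Filter.Tendsto (fun x : V => (⟪u, x⟫)⁻¹ • (ℝ ∙ u)ᗮ.orthogonalProjectionOnto x)
      (nhds u) (nhds 0) := by
    have : ContinuousAt (fun x : V => (⟪u, x⟫)⁻¹ • (ℝ ∙ u)ᗮ.orthogonalProjectionOnto x) u := by
      refine ContinuousAt.smul (f := fun x : V => (⟪u, x⟫)⁻¹) (g := fun x : V => (ℝ ∙ u)ᗮ.orthogonalProjectionOnto x) (ContinuousAt.inv₀ (f := fun x : V => ⟪u, x⟫) (by fun_prop) ?_) (by fun_prop)
      simp [hu0]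
    have h2 := this.tendsto
    rwa [Submodule.orthogonalProjectionOnto_orthogonal_apply_eq_zero (Submodule.mem_span_singleton_self u), smul_zero] at h2
  have hpos : ∀ᶠ x in nhds u, 0 < ⟪u, x⟫ := by
    refine ContinuousAt.eventually_lt (f := fun _ => (0:ℝ)) continuousAt_const (by fun_prop) ?_
    simp [hu1]
  refine ⟨_, ?_, hfin⟩
  rw [mem_nhdsWithin_iff_eventually]
  filter_upwards [hmaps.eventually ht2, hpos] with x hx hx0 hxs
  refine ⟨_, hx, ?_⟩
  have hx1 : ‖x‖ = 1 := by simpa using hxs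
  have hdec : u + (((⟪u, x⟫)⁻¹ • (ℝ ∙ u)ᗮ.orthogonalProjectionOnto x : (ℝ ∙ u)ᗮ) : V) = (⟪u, x⟫)⁻¹ • x := by
    have h1 := Submodule.starProjection_add_starProjection_orthogonal (K := ℝ ∙ u) x
    have h2 : (ℝ ∙ u).starProjection x = ⟪u, x⟫ • u := by
      rw [Submodule.starProjection_unit_singleton ℝ hu1]
    rw [h2] at h1
    have h3 := congrArg (fun z => (⟪u, x⟫)⁻¹ • z) h1
    simp only [smul_add, smul_smul, inv_mul_cancel₀ hx0.ne', one_smul] at h3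
    rw [← h3]
    simp only [Submodule.starProjection_apply, Submodule.coe_smul]
  simp only [γ]
  rw [hdec, norm_smul, hx1, norm_inv, Real.norm_of_nonneg hx0.le]
  simp [smul_smul, hx0.ne']

theorem muS_pos (j : ℕ) (hj : Module.finrank ℝ V = j + 1) :
    0 < μH[(j:ℝ)] (sphere (0:V) 1) := by
  have : Nontrivial V := Module.nontrivial_of_finrank_pos (R := ℝ) (by omega)
  obtain ⟨u, hu1⟩ := exists_norm_eq V (zero_le_one (α := ℝ))
  have hu0 : u ≠ 0 := fun h => by simp [h] at hu1
  have : Fact (Module.finrank ℝ V = j + 1) := ⟨hj⟩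
  have hW : Module.finrank ℝ (ℝ ∙ u)ᗮ = j := Submodule.finrank_orthogonal_span_singleton hu0
  refine lt_of_lt_of_le ?_ (hausdorffMeasure_orthogonalProjectionOnto_le (𝕜 := ℝ) (ℝ ∙ u)ᗮ (j:ℝ) (sphere (0:V) 1) (by positivity))
  refine lt_of_lt_of_le (b := μH[(j:ℝ)] (ball (0 : (ℝ ∙ u)ᗮ) 1)) ?_ (measure_mono ?_)
  · have : 0 < (μH[(Module.finrank ℝ (ℝ ∙ u)ᗮ : ℝ)] (ball (0 : (ℝ ∙ u)ᗮ) 1)) := measure_ball_pos _ _ one_pos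
    rwa [hW] at this
  intro y hy
  have hy1 : ‖y‖ < 1 := by simpa using hy
  have horth : ⟪(y:V), u⟫ = 0 := by
    have := y.2
    rw [Submodule.mem_orthogonal_singleton_iff_inner_left] at this
    exact this
  refine ⟨y + √(1 - ‖y‖^2) • u, ?_, ?_⟩
  · have : ‖(y:V) + √(1 - ‖y‖^2) • u‖^2 = 1 := by
      rw [norm_add_sq_real, inner_smul_right, horth, norm_smul, hu1]
      have : 0 ≤ 1 - ‖y‖^2 := by nlinarith [norm_nonneg y]
      have h9 : ‖(y:V)‖ = ‖y‖ := rfl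
      rw [h9, Real.norm_of_nonneg (Real.sqrt_nonneg _), mul_one, Real.sq_sqrt this]; ring
    have h3 : ‖(y:V) + √(1 - ‖y‖^2) • u‖ = 1 := by
      rwa [pow_eq_one_iff_of_nonneg (norm_nonneg _) two_ne_zero] at this
    simpa using h3
  · simp [Submodule.orthogonalProjectionOnto_orthogonal_apply_eq_zero (Submodule.mem_span_singleton_self u)]

theorem sphere_hausdorff (j : ℕ) (hj : Module.finrank ℝ V = j + 1) :
    ∃ c : ℝ, 0 < c ∧ ∀ f : V → ℝ, ContinuousOn f (sphere 0 1) →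
      ∫ x in sphere (0:V) 1, f x ∂μH[(j:ℝ)] =
        c * ∫ x : sphere (0:V) 1, f x ∂(volume : Measure V).toSphere := by
  have : Nontrivial V := Module.nontrivial_of_finrank_pos (R := ℝ) (by omega)
  have hs : MeasurableSet (sphere (0:V) 1) := isClosed_sphere.measurableSet
  let m := (μH[(j:ℝ)].comap (Subtype.val : sphere (0:V) 1 → V))
  have hmu : m univ = μH[(j:ℝ)] (sphere (0:V) 1) := by
    rw [comap_subtype_coe_apply hs, image_univ, Subtype.range_coe]
  have : IsFiniteMeasure m := ⟨by rw [hmu]; exact muS_finite j hj⟩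
  have hs0 : 0 < (volume : Measure V).toSphere.real univ := by
    refine ENNReal.toReal_pos ?_ (measure_ne_top _ _)
    rw [Ne, Measure.measure_univ_eq_zero]
    exact Measure.toSphere_ne_zero _
  have hm0 : 0 < m.real univ := by
    refine ENNReal.toReal_pos ?_ (measure_ne_top _ _)
    rw [hmu]; exact (muS_pos j hj).ne'
  refine ⟨m.real univ / (volume : Measure V).toSphere.real univ, by positivity, fun f hf => ?_⟩
  have key := unif_unique m (volume : Measure V).toSphere (fun x y r => muS_ball _ x y r)
    (fun x y r => sigma_ball x y r) (fun x r hr => measure_closedBall_pos _ _ hr)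
    (fun x => f x.1) (continuousOn_iff_continuous_domRestrict.1 hf)
  rw [← integral_subtype_comap hs f, div_mul_eq_mul_div, eq_div_iff hs0.ne', ← key]
  ring

end sph
end IB



namespace IB
open Metric

/-- `J` parametrizes the hyperplane orthogonal to `ξ`. -/
structure Fr {N : ℕ} (ξ : EuclideanSpace ℝ (Fin (N+1)))
    (J : EuclideanSpace ℝ (Fin N) →ₗᵢ[ℝ] EuclideanSpace ℝ (Fin (N+1))) : Prop where
  unit : ‖ξ‖ = 1
  orth : ∀ y, ⟪J y, ξ⟫ = 0
  surj : ∀ x, ⟪x, ξ⟫ = 0 → ∃ y, J y = x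
  mp : MeasurePreserving (fun p : ℝ × EuclideanSpace ℝ (Fin N) => J p.2 + p.1 • ξ)
    (volume.prod volume) volume
  emb : MeasurableEmbedding (fun p : ℝ × EuclideanSpace ℝ (Fin N) => J p.2 + p.1 • ξ)

theorem exists_fr {N : ℕ} (ξ : EuclideanSpace ℝ (Fin (N+1))) (hξ : ‖ξ‖ = 1) :
    ∃ J, Fr ξ J := by
  have hu0 : ξ ≠ 0 := fun h => by simp [h] at hξ
  have : Fact (Module.finrank ℝ (EuclideanSpace ℝ (Fin (N+1))) = N + 1) := ⟨by simp⟩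
  let b := OrthonormalBasis.fromOrthogonalSpanSingleton (𝕜 := ℝ) N hu0
  let J : EuclideanSpace ℝ (Fin N) →ₗᵢ[ℝ] EuclideanSpace ℝ (Fin (N+1)) :=
    (ℝ ∙ ξ)ᗮ.subtypeₗᵢ.comp b.repr.symm.toLinearIsometry
  have orth : ∀ y, ⟪J y, ξ⟫ = 0 := fun y => by
    have := (b.repr.symm y).2
    rw [Submodule.mem_orthogonal_singleton_iff_inner_left] at this
    exact this
  have surj : ∀ x, ⟪x, ξ⟫ = 0 → ∃ y, J y = x := fun x hx => by
    refine ⟨b.repr ⟨x, Submodule.mem_orthogonal_singleton_iff_inner_left.2 hx⟩, ?_⟩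
    simp [J]
  let L0 : WithLp 2 (ℝ × EuclideanSpace ℝ (Fin N)) →ₗᵢ[ℝ] EuclideanSpace ℝ (Fin (N+1)) :=
    { toFun := fun p => J p.snd + p.fst • ξ
      map_add' := fun p q => by simp [add_smul]; abel
      map_smul' := fun c p => by simp [mul_smul]
      norm_map' := fun p => by
        have : ‖J p.snd + p.fst • ξ‖ ^ 2 = ‖p‖ ^ 2 := by
          rw [norm_add_sq_real, inner_smul_right, orth, norm_smul, hξ, WithLp.prod_norm_sq_eq_of_L2]
          simp; ring
        exact (sq_eq_sq₀ (norm_nonneg _) (norm_nonneg _)).1 this }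
  have hfr : Module.finrank ℝ (WithLp 2 (ℝ × EuclideanSpace ℝ (Fin N))) =
      Module.finrank ℝ (EuclideanSpace ℝ (Fin (N+1))) := by
    rw [(WithLp.linearEquiv 2 ℝ (ℝ × EuclideanSpace ℝ (Fin N))).finrank_eq]
    simp [add_comm]
  let L := L0.toLinearIsometryEquiv hfr
  have hmp : MeasurePreserving (fun p : ℝ × EuclideanSpace ℝ (Fin N) => J p.2 + p.1 • ξ)
    (volume.prod volume) volume :=
    L.measurePreserving.comp (WithLp.volume_preserving_toLp ℝ (EuclideanSpace ℝ (Fin N)))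
  refine ⟨J, hξ, orth, surj, hmp, ?_⟩
  exact L.toHomeomorph.measurableEmbedding.comp
    (MeasurableEquiv.toLp 2 (ℝ × EuclideanSpace ℝ (Fin N))).measurableEmbedding

theorem Fr.range {N : ℕ} {ξ : EuclideanSpace ℝ (Fin (N+1))} {J} (h : Fr ξ J) :
    range J = {x | ⟪x, ξ⟫ = 0} := by
  ext x; constructor
  · rintro ⟨y, rfl⟩; exact h.orth y
  · exact fun hx => h.surj x hx

theorem radon_param (k : ℕ) : ∃ c : ℝ, 0 < c ∧ ∀ (ξ : EuclideanSpace ℝ (Fin (k+2))) J, Fr ξ J →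
    ∀ f : EuclideanSpace ℝ (Fin (k+2)) → ℝ, ContinuousOn f (sphere 0 1) →
    ∫ x in sphere (0 : EuclideanSpace ℝ (Fin (k+2))) 1 ∩ {x | ⟪x, ξ⟫ = 0}, f x ∂μH[(k:ℝ)] =
      c * ∫ θ : sphere (0 : EuclideanSpace ℝ (Fin (k+1))) 1, f (J θ)
        ∂(volume : Measure (EuclideanSpace ℝ (Fin (k+1)))).toSphere := by
  obtain ⟨c, hc, H⟩ := sphere_hausdorff (V := EuclideanSpace ℝ (Fin (k+1))) k (by simp)
  refine ⟨c, hc, fun ξ J h f hf => ?_⟩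
  have hpre : J ⁻¹' (sphere 0 1) = sphere 0 1 := by ext; simp
  rw [← H (fun y => f (J y)) (hf.comp J.continuous.continuousOn fun y hy => by
    rw [← hpre] at hy; exact hy)]
  have h1 := J.isometry.map_hausdorffMeasure (d := k) (Or.inl (by positivity))
  have hemb : MeasurableEmbedding J := J.isometry.isClosedEmbedding.measurableEmbedding
  rw [← h.range, ← Measure.restrict_restrict isClosed_sphere.measurableSet, ← h1,
    hemb.setIntegral_map, hpre]

theorem section_param (N : ℕ) : ∃ c : ℝ, 0 < c ∧ ∀ (ξ : EuclideanSpace ℝ (Fin (N+1))) J, Fr ξ J →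
    ∀ (K : Set (EuclideanSpace ℝ (Fin (N+1)))) (z : ℝ),
    (μH[(N:ℝ)] (K ∩ {x | ⟪x, ξ⟫ = z})).toReal =
      c * (volume : Measure (EuclideanSpace ℝ (Fin N))).real {y | J y + z • ξ ∈ K} := by
  let V := EuclideanSpace ℝ (Fin N)
  have hH : (μH[(N:ℝ)] : Measure V).IsAddHaarMeasure := by
    have : (μH[(Module.finrank ℝ V : ℝ)] : Measure V).IsAddHaarMeasure := inferInstance
    simpa [V] using this
  have e := Measure.isAddLeftInvariant_eq_smul (μH[(N:ℝ)] : Measure V) volume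
  refine ⟨Measure.addHaarScalarFactor (μH[(N:ℝ)] : Measure V) volume,
    Measure.addHaarScalarFactor_pos_of_isAddHaarMeasure _ _, fun ξ J h K z => ?_⟩
  have hiso : Isometry (fun y => J y + z • ξ) := by
    intro x y; simp [J.isometry.edist_eq]
  have him : K ∩ {x | ⟪x, ξ⟫ = z} = (fun y => J y + z • ξ) '' {y | J y + z • ξ ∈ K} := by
    have hxx : ⟪ξ, ξ⟫ = 1 := by rw [real_inner_self_eq_norm_sq, h.unit]; norm_num
    ext x; constructor
    · rintro ⟨hx, hz⟩
      obtain ⟨y, hy⟩ := h.surj (x - z • ξ) (by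
        rw [inner_sub_left, inner_smul_left, hxx]; simpa [sub_eq_zero] using hz)
      have : J y + z • ξ = x := by rw [hy]; abel
      exact ⟨y, by simpa [this] using hx, this⟩
    · rintro ⟨y, hy, rfl⟩
      refine ⟨hy, ?_⟩
      simp [inner_add_left, inner_smul_left, h.orth, hxx, h.unit]
  rw [him, hiso.hausdorffMeasure_image (Or.inl (by positivity))]
  refine (congrArg (fun m : Measure V => (m {y | J y + z • ξ ∈ K}).toReal) e).trans ?_
  simp only [Measure.real]
  rw [Measure.smul_apply]
  simp only [ENNReal.smul_def, smul_eq_mul, ENNReal.toReal_mul, ENNReal.coe_toReal]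
  rfl

end IB



namespace IB
open Metric SchwartzMap FourierTransform

theorem schwartz_bound {D : Type*} [NormedAddCommGroup D] [NormedSpace ℝ D] (F : 𝓢(D, ℂ)) (r : ℕ) :
    ∃ C : ℝ, 0 ≤ C ∧ ∀ x, ‖F x‖ ≤ C * (1 + ‖x‖) ^ (-(r:ℝ)) := by
  refine ⟨2 ^ r * ((Finset.Iic (r, 0)).sup fun m => SchwartzMap.seminorm ℝ m.1 m.2) F, ?_, fun x => ?_⟩
  · exact mul_nonneg (by positivity) (apply_nonneg _ _)
  · have h := one_add_le_sup_seminorm_apply (𝕜 := ℝ) (m := (r,0)) le_rfl le_rfl F x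
    rw [norm_iteratedFDeriv_zero] at h
    have hp : 0 < (1 + ‖x‖) := by positivity
    rw [Real.rpow_neg hp.le, Real.rpow_natCast, ← div_eq_mul_inv, le_div_iff₀ (by positivity), mul_comm]
    exact h

theorem Fr.le_norm {N : ℕ} {ξ : EuclideanSpace ℝ (Fin (N+1))} {J} (h : Fr ξ J) (y) (z : ℝ) :
    ‖y‖ ≤ ‖J y + z • ξ‖ := by
  have : ‖J y + z • ξ‖ ^ 2 = ‖y‖ ^ 2 + z ^ 2 := by
    rw [norm_add_sq_real, inner_smul_right, h.orth, norm_smul, h.unit]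
    simp
  exact abs_le_of_sq_le_sq' (by nlinarith [sq_nonneg z]) (norm_nonneg _) |>.2

theorem slice_bd {N : ℕ} (F : 𝓢(EuclideanSpace ℝ (Fin (N+1)), ℂ)) :
    ∃ b : EuclideanSpace ℝ (Fin N) → ℝ, Integrable b ∧ ∀ ξ J, Fr ξ J → ∀ y (z : ℝ),
      ‖F (J y + z • ξ)‖ ≤ b y := by
  obtain ⟨C, hC, H⟩ := schwartz_bound F (N+1)
  refine ⟨fun y => C * (1 + ‖y‖) ^ (-((N+1:ℕ):ℝ)), ?_, fun ξ J h y z => (H _).trans ?_⟩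
  · exact (integrable_one_add_norm (by simp)).const_mul _
  · refine mul_le_mul_of_nonneg_left ?_ hC
    exact Real.rpow_le_rpow_of_nonpos (by positivity) (by linarith [h.le_norm y z]) (by simp; linarith)

theorem slice_cont {N : ℕ} (F : 𝓢(EuclideanSpace ℝ (Fin (N+1)), ℂ)) {ξ J} (h : Fr ξ J) :
    Continuous (fun z : ℝ => ∫ y, F (J y + z • ξ)) := by
  obtain ⟨b, hb, H⟩ := slice_bd F
  have hJ := J.continuous
  have hF := F.continuous
  refine continuous_of_dominated (bound := b) (fun z => ?_) (fun z => ?_) hb ?_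
  · exact Continuous.aestronglyMeasurable (by fun_prop)
  · exact Filter.Eventually.of_forall fun y => H ξ J h y z
  · exact Filter.Eventually.of_forall fun y => by fun_prop

theorem slice_integrable {N : ℕ} (F : 𝓢(EuclideanSpace ℝ (Fin (N+1)), ℂ)) {ξ J} (h : Fr ξ J) (z : ℝ) :
    Integrable (fun y => F (J y + z • ξ)) := by
  obtain ⟨b, hb, H⟩ := slice_bd F
  have hJ := J.continuous
  have hF := F.continuous
  exact hb.mono' (Continuous.aestronglyMeasurable (by fun_prop))
    (Filter.Eventually.of_forall fun y => H ξ J h y z)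

theorem slice_fourier {N : ℕ} (F : 𝓢(EuclideanSpace ℝ (Fin (N+1)), ℂ)) {ξ J} (h : Fr ξ J) :
    Integrable (fun z : ℝ => ∫ y, F (J y + z • ξ)) ∧
    𝓕 (fun z : ℝ => ∫ y, F (J y + z • ξ)) = fun s : ℝ => (𝓕 F) (s • ξ) := by
  have hint : Integrable (fun p : ℝ × EuclideanSpace ℝ (Fin N) => F (J p.2 + p.1 • ξ))
      (volume.prod volume) := (h.mp.integrable_comp_emb h.emb).2 F.integrable
  refine ⟨hint.integral_prod_left, ?_⟩
  ext s
  rw [Real.fourier_real_eq, SchwartzMap.fourier_coe, Real.fourier_eq]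
  rw [← h.mp.integral_comp h.emb, integral_prod]
  · congr 1; ext z
    simp only [Circle.smul_def]
    rw [← integral_smul]
    congr 1; ext y
    simp [inner_add_left, inner_smul_left, inner_smul_right, h.orth, h.unit, mul_comm]
  · refine (h.mp.integrable_comp_emb h.emb
      (g := fun v => Real.fourierChar (-⟪v, s • ξ⟫) • F v)).2 ?_
    exact (VectorFourier.fourierIntegral_convergent_iff Real.continuous_fourierChar
      (L := innerₗ _) continuous_inner _).2 F.integrable

/-- weighted line integrals -/
noncomputable def line {D : Type*} [NormedAddCommGroup D] [NormedSpace ℝ D] (k : ℕ) (Ψ : D → ℂ)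
    (x : D) : ℂ := ∫ s : ℝ, (s:ℂ) ^ k * Ψ (s • x)

theorem line_bd {D : Type*} [NormedAddCommGroup D] [NormedSpace ℝ D] (k : ℕ) (Ψ : 𝓢(D, ℂ)) :
    ∃ b : ℝ → ℝ, Integrable b ∧ ∀ x, ‖x‖ = 1 → ∀ s : ℝ, ‖(s:ℂ) ^ k * Ψ (s • x)‖ ≤ b s := by
  obtain ⟨C, hC, H⟩ := schwartz_bound Ψ (k+2)
  refine ⟨fun y => C * (1 + ‖y‖) ^ (-((2:ℕ):ℝ)), ?_, fun x hx s => ?_⟩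
  · exact (integrable_one_add_norm (by simp)).const_mul _
  · have h1 := H (s • x)
    have hp : 0 < 1 + ‖s‖ := by positivity
    rw [norm_smul, hx, mul_one, Real.rpow_neg hp.le, Real.rpow_natCast] at h1
    beta_reduce
    rw [Real.rpow_neg hp.le, Real.rpow_natCast, norm_mul, norm_pow, Complex.norm_real]
    have h2 : ‖s‖ ^ k ≤ (1 + ‖s‖) ^ k := by gcongr; linarith
    calc _ ≤ (1 + ‖s‖) ^ k * (C * ((1 + ‖s‖) ^ (k+2))⁻¹) := by gcongr
      _ = _ := by field_simp; ring

theorem line_integrable {D : Type*} [NormedAddCommGroup D] [NormedSpace ℝ D] (k : ℕ) (Ψ : 𝓢(D, ℂ))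
    (x : D) (hx : ‖x‖ = 1) : Integrable (fun s : ℝ => (s:ℂ) ^ k * Ψ (s • x)) := by
  obtain ⟨b, hb, H⟩ := line_bd k Ψ
  have hF := Ψ.continuous
  exact hb.mono' (Continuous.aestronglyMeasurable (by fun_prop))
    (Filter.Eventually.of_forall fun y => H x hx y)

theorem line_cont {D : Type*} [NormedAddCommGroup D] [NormedSpace ℝ D] (k : ℕ) (Ψ : 𝓢(D, ℂ)) :
    ContinuousOn (line k Ψ) (sphere 0 1) := by
  obtain ⟨b, hb, H⟩ := line_bd k Ψ
  have hF := Ψ.continuous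
  refine continuousOn_of_dominated (bound := b) (fun z _ => ?_) (fun z hz => ?_) hb ?_
  · exact Continuous.aestronglyMeasurable (by fun_prop)
  · exact Filter.Eventually.of_forall fun y => H z (by simpa using hz) y
  · exact Filter.Eventually.of_forall fun y => Continuous.continuousOn (by fun_prop)

theorem line_neg {D : Type*} [NormedAddCommGroup D] [NormedSpace ℝ D] (k : ℕ) (hk : Even k)
    (Ψ : D → ℂ) (x : D) : line k Ψ (-x) = line k Ψ x := by
  unfold line
  rw [← integral_neg_eq_self]
  congr 1; ext s; simp [hk.neg_pow]

theorem slice {N : ℕ} (k : ℕ) (hk : Even k) (F : 𝓢(EuclideanSpace ℝ (Fin (N+1)), ℂ)) {ξ J}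
    (h : Fr ξ J) :
    iteratedDeriv k (fun z : ℝ => ∫ y, F (J y + z • ξ)) 0 =
      (2 * Real.pi : ℂ) ^ k * (-1) ^ (k / 2) * line k (𝓕 F : 𝓢(_, ℂ)) ξ := by
  obtain ⟨h1, h2⟩ := slice_fourier F h
  have hg : ∀ j : ℕ, Integrable (fun s : ℝ => s ^ j • (𝓕 F) (s • ξ)) := fun j => by
    simpa using line_integrable j (𝓕 F) ξ h.unit
  have h3 := (slice_cont F h).fourierInv_fourier_eq h1 (by rw [h2]; simpa using hg 0)
  rw [← h3, h2, Real.fourierInv_eq_fourier_comp_neg,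
    Real.iteratedDeriv_fourier (N := ⊤) (fun j _ => ?_) le_top, Real.fourier_real_eq]
  · unfold line
    rw [← integral_neg_eq_self, ← integral_const_mul]
    congr 1; ext s
    obtain ⟨j, rfl⟩ := hk
    have : (-(Complex.I * Complex.I)) = 1 := by simp
    have e : (j + j) / 2 = j := by omega
    have e2 : (-1 : ℂ) ^ j = (Complex.I)^(j+j) := by rw [← two_mul, pow_mul]; simp
    simp [e, e2, mul_pow]
    ring
  · have := (hg j).comp_neg.smul ((-1 : ℝ) ^ j)
    refine this.congr (Filter.Eventually.of_forall fun s => ?_)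
    simp only [Pi.smul_apply]
    rw [smul_smul, ← mul_pow]
    simp

theorem line_sphere (k : ℕ) (hk : Even k) (Ψ : 𝓢(EuclideanSpace ℝ (Fin (k+2)), ℂ)) {ξ J}
    (h : Fr ξ J) :
    ∫ θ : sphere (0 : EuclideanSpace ℝ (Fin (k+1))) 1, line k Ψ (J θ)
        ∂(volume : Measure (EuclideanSpace ℝ (Fin (k+1)))).toSphere = 2 * ∫ y, Ψ (J y) := by
  have hi : Integrable (fun y => Ψ (J y)) := by simpa using slice_integrable Ψ h 0
  obtain ⟨a1, a2⟩ := polar_int volume _ hi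
  obtain ⟨b1, b2⟩ := polar_int volume _ hi.comp_neg
  rw [integral_neg_eq_self (fun x => Ψ (J x))] at b2
  rw [two_mul]
  nth_rewrite 1 [a2]
  rw [b2, ← integral_add a1 b1]
  congr 1; ext θ
  have hθ : ‖J θ.1‖ = 1 := by simp
  have hl := line_integrable k Ψ (J θ.1) hθ
  unfold line
  rw [← integral_add_compl (s := Ioi (0:ℝ)) measurableSet_Ioi hl]
  congr 1
  · simp
  · rw [compl_Ioi, ← neg_zero, ← integral_comp_neg_Ioi]
    simp [hk.neg_pow]

/-- inversion of the spherical Radon transform -/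
theorem radon_line (k : ℕ) (hk : Even k) (Φ : 𝓢(EuclideanSpace ℝ (Fin (k+2)), ℂ)) {ξ J}
    (h : Fr ξ J) :
    ∫ θ : sphere (0 : EuclideanSpace ℝ (Fin (k+1))) 1, line k (𝓕 Φ : 𝓢(_, ℂ)) (J θ)
        ∂(volume : Measure (EuclideanSpace ℝ (Fin (k+1)))).toSphere = 2 * line 0 Φ ξ := by
  have h0 := slice 0 Even.zero (𝓕 Φ) h
  rw [line_sphere k hk _ h]
  simp at h0
  rw [h0, ← line_neg 0 Even.zero Φ]
  congr 1
  have : ∀ x, (𝓕 (𝓕 Φ)) x = Φ (-x) := fun x => by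
    have e : (𝓕⁻ (𝓕 Φ)) (-x) = Φ (-x) := by rw [FourierTransform.fourierInv_fourier_eq]
    rw [← e, SchwartzMap.fourierInv_coe, Real.fourierInv_eq_fourier_neg, neg_neg, SchwartzMap.fourier_coe]
  unfold line
  simp [this]

end IB



namespace IB
open Metric

/-- the bump centered at 2 -/
noncomputable def phiB : ContDiffBump (2:ℝ) := ⟨1/2, 1, by norm_num, by norm_num⟩

/-- the bump function -/
noncomputable def phi : ℝ → ℝ := phiB

theorem phi_contDiff {n : ℕ∞} : ContDiff ℝ n phi := phiB.contDiff
theorem phi_cont : Continuous phi := phiB.continuous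
theorem phi_nonneg (t) : 0 ≤ phi t := phiB.nonneg
theorem phi_le_one (t) : phi t ≤ 1 := phiB.le_one
theorem phi_zero {t : ℝ} (h : t ≤ 1 ∨ 3 ≤ t) : phi t = 0 := by
  apply phiB.zero_of_le_dist
  change (1:ℝ) ≤ _
  rw [Real.dist_eq]
  rcases h with h | h
  · rw [abs_sub_comm]; exact le_trans (by linarith) (le_abs_self _)
  · exact le_trans (by linarith) (le_abs_self _)
theorem phi_two : phi 2 = 1 := phiB.one_of_mem_closedBall (by simp [phiB])
theorem phi_cs : HasCompactSupport phi := phiB.hasCompactSupport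

theorem phi_wint (j : ℕ) : 0 < ∫ r in Ioi (0:ℝ), r ^ j * phi r := by
  rw [setIntegral_eq_integral_of_forall_compl_eq_zero]
  · have : ∀ r, r ^ j * phi r = |r| ^ j * phi r := fun r => by
      by_cases h : r ≤ 1
      · simp [phi_zero (Or.inl h)]
      · rw [abs_of_pos (by linarith)]
    simp_rw [this]
    apply Continuous.integral_pos_of_hasCompactSupport_nonneg_nonzero (x := 2)
    · have := phi_cont
      fun_prop
    · exact phi_cs.mul_left
    · intro r
      exact mul_nonneg (by positivity) (phi_nonneg _)
    · simp [phi_two]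
  · intro r hr
    simp at hr
    simp [phi_zero (Or.inl (hr.trans zero_le_one))]

theorem phi_int : 0 < ∫ r, phi r :=
  Continuous.integral_pos_of_hasCompactSupport_nonneg_nonzero (x := 2) phi_cont phi_cs phi_nonneg
    (by simp [phi_two])

/-- radial-bump extension -/
noncomputable def ext {V : Type*} [NormedAddCommGroup V] [NormedSpace ℝ V] (f : V → ℝ) (x : V) : ℝ :=
  phi ‖x‖ * f (‖x‖⁻¹ • x)

theorem ext_cont {V : Type*} [NormedAddCommGroup V] [NormedSpace ℝ V] {f : V → ℝ}
    (hf : Continuous f) : Continuous (ext f) := by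
  rw [continuous_iff_continuousAt]
  intro x
  by_cases hx : x = 0
  · subst hx
    refine ContinuousAt.congr (f := fun _ => (0:ℝ)) continuousAt_const ?_
    filter_upwards [ball_mem_nhds (0:V) one_pos] with y hy
    simp at hy
    simp [ext, phi_zero (Or.inl hy.le)]
  · unfold ext
    refine ContinuousAt.mul (phi_cont.continuousAt.comp continuous_norm.continuousAt) ?_
    refine ContinuousAt.comp hf.continuousAt ?_
    exact (continuous_norm.continuousAt.inv₀ (norm_ne_zero_iff.2 hx)).smul continuousAt_id

theorem ext_bd {V : Type*} [NormedAddCommGroup V] [NormedSpace ℝ V] [FiniteDimensional ℝ V] {f : V → ℝ}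
    (hf : Continuous f) : ∃ M : ℝ, 0 ≤ M ∧ ∀ x, |ext f x| ≤ M * (closedBall (0:V) 3).indicator 1 x := by
  have : ProperSpace V := FiniteDimensional.proper ℝ V
  obtain ⟨M, hM⟩ := (isCompact_closedBall (0:V) 1).exists_bound_of_continuousOn hf.continuousOn
  have hM0 : 0 ≤ M := (norm_nonneg _).trans (hM 0 (by simp))
  refine ⟨M, hM0, fun x => ?_⟩
  by_cases hx : x ∈ closedBall (0:V) 3
  · simp only [hx, indicator_of_mem, Pi.one_apply, mul_one, ext, abs_mul]
    rw [abs_of_nonneg (phi_nonneg _)]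
    have h1 := hM (‖x‖⁻¹ • x) (by
      simp [norm_smul]
      by_cases h : x = 0
      · simp [h]
      · rw [inv_mul_cancel₀ (norm_ne_zero_iff.2 h)])
    calc _ ≤ 1 * M := mul_le_mul (phi_le_one _) h1 (abs_nonneg _) zero_le_one
      _ = M := one_mul _
  · simp only [hx, not_false_eq_true, indicator_of_notMem, mul_zero]
    simp at hx
    simp [ext, phi_zero (Or.inr hx.le)]

theorem ind_int {V : Type*} [NormedAddCommGroup V] [NormedSpace ℝ V] [FiniteDimensional ℝ V]
    [MeasurableSpace V] [BorelSpace V] (μ : Measure V) [IsFiniteMeasureOnCompacts μ] (M : ℝ) :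
    Integrable (fun x => M * (closedBall (0:V) 3).indicator 1 x) μ := by
  have : ProperSpace V := FiniteDimensional.proper ℝ V
  apply Integrable.const_mul
  rw [integrable_indicator_iff measurableSet_closedBall]
  exact (continuous_const (y := (1:ℝ))).continuousOn.integrableOn_compact (isCompact_closedBall _ _)

theorem ext_int {V : Type*} [NormedAddCommGroup V] [NormedSpace ℝ V] [FiniteDimensional ℝ V]
    [MeasurableSpace V] [BorelSpace V] (μ : Measure V) [IsFiniteMeasureOnCompacts μ] {f : V → ℝ}
    (hf : Continuous f) : Integrable (ext f) μ := by
  obtain ⟨M, hM, H⟩ := ext_bd hf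
  exact (ind_int μ M).mono' (ext_cont hf).aestronglyMeasurable (Filter.Eventually.of_forall H)

section adj
variable {k : ℕ}

theorem ext_slice {f : EuclideanSpace ℝ (Fin (k+1)) → ℝ} (hf : Continuous f) :
    ∃ B : ℝ, 0 ≤ B ∧ ∀ ξ J, Fr ξ J → Continuous (fun z : ℝ => ∫ y, ext f (J y + z • ξ)) ∧
      ∀ z : ℝ, |∫ y, ext f (J y + z • ξ)| ≤ B := by
  obtain ⟨M, hM, H⟩ := ext_bd hf
  have hb : ∀ ξ J, Fr ξ J → ∀ (z : ℝ) y, |ext f (J y + z • ξ)| ≤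
      M * (closedBall (0:EuclideanSpace ℝ (Fin k)) 3).indicator 1 y := fun ξ J h z y => by
    refine (H _).trans (mul_le_mul_of_nonneg_left ?_ hM)
    by_cases hx : y ∈ closedBall (0:EuclideanSpace ℝ (Fin k)) 3
    · rw [indicator_of_mem hx]
      exact indicator_le_self' (fun _ _ => zero_le_one) _
    · rw [indicator_of_notMem hx, indicator_of_notMem]
      simp at hx ⊢
      exact hx.trans_le (h.le_norm y z)
  refine ⟨∫ y, M * (closedBall (0:EuclideanSpace ℝ (Fin k)) 3).indicator 1 y, ?_, fun ξ J h => ⟨?_, fun z => ?_⟩⟩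
  · exact integral_nonneg fun y => mul_nonneg hM (indicator_nonneg (fun _ _ => zero_le_one) _)
  · have hJ := J.continuous
    have hF := ext_cont hf
    refine continuous_of_dominated (fun z => ?_) (fun z => ?_) (ind_int volume M) ?_
    · exact Continuous.aestronglyMeasurable (by fun_prop)
    · exact Filter.Eventually.of_forall fun y => hb ξ J h z y
    · exact Filter.Eventually.of_forall fun y => by fun_prop
  · have := norm_integral_le_of_norm_le (f := fun y => ext f (J y + z • ξ)) (ind_int volume M)
      (Filter.Eventually.of_forall (hb ξ J h z))
    exact this

/-- smoothed integrals over hyperplanes -/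
noncomputable def Dj (f : EuclideanSpace ℝ (Fin (k+1)) → ℝ) (j : ℕ) (w : EuclideanSpace ℝ (Fin (k+1))) : ℝ :=
  ∫ x, ext f x * ((j+1:ℝ) * phi ((j+1) * ⟪x, w⟫))

theorem Dj_eq {f : EuclideanSpace ℝ (Fin (k+1)) → ℝ} (hf : Continuous f) {ξ J} (h : Fr ξ J) (j : ℕ)
    {c : ℝ} (hc : 0 < c) : Dj f j (c • ξ) =
      c⁻¹ * ∫ u, (∫ y, ext f (J y + (((j+1:ℝ) * c)⁻¹ * u) • ξ)) * phi u := by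
  have hint : Integrable (fun x => ext f x * ((j+1:ℝ) * phi ((j+1) * ⟪x, c • ξ⟫))) := by
    refine (ext_int volume hf).mul_bdd (c := j + 1) ?_ ?_
    · have := phi_cont
      exact Continuous.aestronglyMeasurable (by fun_prop)
    · refine Filter.Eventually.of_forall fun x => ?_
      rw [norm_mul, Real.norm_of_nonneg (by positivity), Real.norm_of_nonneg (phi_nonneg _)]
      exact mul_le_of_le_one_right (by positivity) (phi_le_one _)
  have hjc : (0:ℝ) < (j+1) * c := by positivity
  unfold Dj
  rw [← h.mp.integral_comp h.emb, integral_prod]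
  · have e1 : ∀ z : ℝ, ∫ y, ext f (J y + z • ξ) * ((j+1:ℝ) * phi ((j+1) * ⟪J y + z • ξ, c • ξ⟫)) =
        (fun u => (j+1:ℝ) * ((∫ y, ext f (J y + (((j+1:ℝ) * c)⁻¹ * u) • ξ)) * phi u)) (((j+1) * c) * z) := fun z => by
      have e2 : ∀ y, ⟪J y + z • ξ, c • ξ⟫ = c * z := fun y => by
        simp [inner_add_left, inner_smul_left, inner_smul_right, h.orth, h.unit]
      simp only [e2]
      rw [integral_mul_const, inv_mul_cancel_left₀ hjc.ne', mul_assoc]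
      ring
    refine (integral_congr_ae (Filter.Eventually.of_forall e1)).trans ?_
    refine (Measure.integral_comp_mul_left (F := ℝ) (fun u =>
      (j+1:ℝ) * ((∫ y, ext f (J y + (((j+1:ℝ) * c)⁻¹ * u) • ξ)) * phi u)) ((j+1) * c)).trans ?_
    rw [abs_of_pos (by positivity), integral_const_mul, smul_eq_mul]
    field_simp
  · exact (h.mp.integrable_comp_emb h.emb).2 hint

theorem Dj_symm {f g : EuclideanSpace ℝ (Fin (k+1)) → ℝ} (hf : Continuous f) (hg : Continuous g) (j : ℕ) :
    ∫ w, ext g w * Dj f j w = ∫ w, ext f w * Dj g j w := by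
  unfold Dj
  simp_rw [← integral_const_mul]
  rw [integral_integral_swap]
  · congr 1; ext x; congr 1; ext w
    rw [real_inner_comm]; ring
  · have h1 : Integrable (fun p : EuclideanSpace ℝ (Fin (k+1)) × EuclideanSpace ℝ (Fin (k+1)) =>
        ext g p.1 * ext f p.2) (volume.prod volume) := (ext_int volume hg).mul_prod (ext_int volume hf)
    have h2 := h1.mul_bdd (g := fun p : EuclideanSpace ℝ (Fin (k+1)) × EuclideanSpace ℝ (Fin (k+1)) =>
        ((j+1:ℝ) * phi ((j+1) * ⟪p.2, p.1⟫))) (c := j + 1)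
      (by
        have := phi_cont
        exact Continuous.aestronglyMeasurable (by fun_prop))
      (Filter.Eventually.of_forall fun x => by
        rw [norm_mul, Real.norm_of_nonneg (by positivity), Real.norm_of_nonneg (phi_nonneg _)]
        exact mul_le_of_le_one_right (by positivity) (phi_le_one _))
    refine h2.congr (Filter.Eventually.of_forall fun p => ?_)
    simp [Function.uncurry, mul_assoc]

theorem Dj_lim {f : EuclideanSpace ℝ (Fin (k+1)) → ℝ} (hf : Continuous f) {ξ J} (h : Fr ξ J)
    {c : ℝ} (hc : 0 < c) : Filter.Tendsto (fun j => Dj f j (c • ξ)) Filter.atTop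
      (nhds (c⁻¹ * ((∫ y, ext f (J y)) * ∫ u, phi u))) := by
  obtain ⟨B, hB, H⟩ := ext_slice hf
  obtain ⟨h1, h2⟩ := H ξ J h
  simp_rw [Dj_eq hf h _ hc]
  refine Filter.Tendsto.const_mul _ ?_
  rw [← integral_const_mul]
  refine tendsto_integral_of_dominated_convergence (fun u => B * phi u) (fun j => ?_) ?_ (fun j => ?_) ?_
  · have := phi_cont
    exact Continuous.aestronglyMeasurable ((h1.comp (continuous_const_mul _)).mul this)
  · exact (phi_cont.integrable_of_hasCompactSupport phi_cs).const_mul _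
  · refine Filter.Eventually.of_forall fun u => ?_
    rw [norm_mul, Real.norm_of_nonneg (phi_nonneg _)]
    exact mul_le_mul_of_nonneg_right (h2 _) (phi_nonneg _)
  · refine Filter.Eventually.of_forall fun u => ?_
    refine Filter.Tendsto.mul_const _ ?_
    have e : (∫ y, ext f (J y)) = (fun z : ℝ => ∫ y, ext f (J y + z • ξ)) 0 := by simp
    rw [e]
    refine (h1.tendsto 0).comp ?_
    have e3 : (0:ℝ) = (0 * c⁻¹) * u := by simp
    rw [e3]
    refine Filter.Tendsto.mul_const _ ?_
    simp_rw [mul_inv]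
    refine Filter.Tendsto.mul_const _ ?_
    simpa using tendsto_one_div_add_atTop_nhds_zero_nat (𝕜 := ℝ)

theorem Dj_bd {f : EuclideanSpace ℝ (Fin (k+1)) → ℝ} (hf : Continuous f) :
    ∃ B : ℝ, 0 ≤ B ∧ ∀ j w, w ≠ 0 → |Dj f j w| ≤ ‖w‖⁻¹ * B := by
  obtain ⟨B, hB, H⟩ := ext_slice hf
  refine ⟨∫ u, B * phi u, integral_nonneg fun u => mul_nonneg hB (phi_nonneg u), fun j w hw => ?_⟩
  have hw' : 0 < ‖w‖ := norm_pos_iff.2 hw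
  obtain ⟨J, h⟩ := exists_fr (‖w‖⁻¹ • w) (by rw [norm_smul]; simp [hw])
  obtain ⟨h1, h2⟩ := H _ J h
  have e : w = ‖w‖ • (‖w‖⁻¹ • w) := by rw [smul_smul, mul_inv_cancel₀ hw'.ne', one_smul]
  have := Dj_eq hf h j hw'
  rw [← e] at this
  rw [this, abs_mul, abs_of_pos (inv_pos.2 hw')]
  refine mul_le_mul_of_nonneg_left ?_ (inv_pos.2 hw').le
  have hi : Integrable phi := phi_cont.integrable_of_hasCompactSupport phi_cs
  rw [← Real.norm_eq_abs]
  refine norm_integral_le_of_norm_le (hi.const_mul _) ?_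
  refine Filter.Eventually.of_forall fun u => ?_
  rw [norm_mul, Real.norm_of_nonneg (phi_nonneg _)]
  exact mul_le_mul_of_nonneg_right (h2 _) (phi_nonneg _)

theorem ext_mul_eq {V : Type*} [NormedAddCommGroup V] [NormedSpace ℝ V] (f : V → ℝ) (x : V) (hx : ‖x‖ < 1) :
    ext f x = 0 := by simp [ext, phi_zero (Or.inl hx.le)]

theorem Dj_cont {f : EuclideanSpace ℝ (Fin (k+1)) → ℝ} (hf : Continuous f) (j : ℕ) :
    Continuous (Dj f j) := by
  have hp := phi_cont
  have he := ext_cont hf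
  unfold Dj
  refine continuous_of_dominated (bound := fun x => ‖ext f x‖ * (j+1)) (fun w => ?_) (fun w => ?_) ?_ ?_
  · exact Continuous.aestronglyMeasurable (by fun_prop)
  · refine Filter.Eventually.of_forall fun u => ?_
    rw [norm_mul]
    refine mul_le_mul_of_nonneg_left ?_ (norm_nonneg _)
    rw [norm_mul, Real.norm_of_nonneg (by positivity), Real.norm_of_nonneg (phi_nonneg _)]
    exact mul_le_of_le_one_right (by positivity) (phi_le_one _)
  · exact (ext_int volume hf).norm.mul_const _
  · exact Filter.Eventually.of_forall fun u => by fun_prop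

end adj

/-- the spherical Radon transform -/
noncomputable def Rad {V : Type*} [NormedAddCommGroup V] [InnerProductSpace ℝ V] [MeasurableSpace V]
    [BorelSpace V] (k : ℕ) (f : V → ℝ) (ξ : V) : ℝ :=
  ∫ x in sphere (0 : V) 1 ∩ {x | ⟪x, ξ⟫ = 0}, f x ∂μH[(k:ℝ)]

theorem ext_Rad (k : ℕ) : ∃ c : ℝ, 0 < c ∧ ∀ f : EuclideanSpace ℝ (Fin (k+2)) → ℝ, Continuous f →
    ∀ ξ J, Fr ξ J → ∫ y, ext f (J y) = c * Rad k f ξ := by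
  obtain ⟨c, hc, H⟩ := radon_param k
  refine ⟨(∫ r in Ioi (0:ℝ), r ^ k * phi r) * c⁻¹, mul_pos (phi_wint k) (inv_pos.2 hc), fun f hf ξ J h => ?_⟩
  unfold Rad
  rw [H ξ J h f hf.continuousOn, mul_assoc, inv_mul_cancel_left₀ hc.ne']
  have := polar_mul (volume : Measure (EuclideanSpace ℝ (Fin (k+1)))) phi (fun y => f (J y))
  simp only [finrank_euclideanSpace_fin, Nat.add_sub_cancel] at this
  rw [← this]
  congr 1; ext y
  simp [ext]

theorem adj_lim (k : ℕ) : ∃ c : ℝ, 0 < c ∧ ∀ f g : EuclideanSpace ℝ (Fin (k+2)) → ℝ, Continuous f →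
    Continuous g → Filter.Tendsto (fun j => ∫ w, ext g w * Dj f j w) Filter.atTop
      (nhds (c * ∫ ξ : sphere (0 : EuclideanSpace ℝ (Fin (k+2))) 1, g ξ * Rad k f ξ ∂volume.toSphere)) := by
  obtain ⟨c, hc, H⟩ := ext_Rad k
  refine ⟨(∫ r in Ioi (0:ℝ), r ^ k * phi r) * (c * ∫ u, phi u),
    mul_pos (phi_wint k) (mul_pos hc phi_int), fun f g hf hg => ?_⟩
  obtain ⟨B, hB, HB⟩ := Dj_bd hf
  have e := polar_mul (volume : Measure (EuclideanSpace ℝ (Fin (k+2)))) (fun r => phi r * r⁻¹)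
    (fun x => (c * ∫ u, phi u) * (g x * Rad k f x))
  rw [integral_const_mul] at e
  have e2 : ∫ r in Ioi (0:ℝ), r ^ (Module.finrank ℝ (EuclideanSpace ℝ (Fin (k+2))) - 1) * (phi r * r⁻¹) =
      ∫ r in Ioi (0:ℝ), r ^ k * phi r := by
    refine setIntegral_congr_fun measurableSet_Ioi fun r hr => ?_
    have hr' : r ≠ 0 := (ne_of_gt hr)
    simp only [finrank_euclideanSpace_fin]
    rw [show k + 2 - 1 = k + 1 from rfl, pow_succ]
    field_simp
  rw [e2] at e
  rw [mul_assoc, ← e]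
  refine tendsto_integral_of_dominated_convergence (fun w => ‖ext g w‖ * B) (fun j => ?_) ?_ (fun j => ?_) ?_
  · exact ((ext_cont hg).mul (Dj_cont hf j)).aestronglyMeasurable
  · exact (ext_int volume hg).norm.mul_const _
  · refine Filter.Eventually.of_forall fun w => ?_
    rw [norm_mul]
    by_cases hw : ‖w‖ < 1
    · simp [ext_mul_eq g w hw]
    · push Not at hw
      refine mul_le_mul_of_nonneg_left ?_ (norm_nonneg _)
      refine (HB j w (norm_pos_iff.1 (by linarith))).trans ?_
      exact mul_le_of_le_one_left hB (inv_le_one_of_one_le₀ hw)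
  · refine Filter.Eventually.of_forall fun w => ?_
    by_cases hw : ‖w‖ < 1
    · simp [ext_mul_eq g w hw, phi_zero (Or.inl hw.le)]
    · push Not at hw
      have hw0 : 0 < ‖w‖ := by linarith
      obtain ⟨J, h⟩ := exists_fr (‖w‖⁻¹ • w) (by rw [norm_smul]; simp [norm_pos_iff.1 hw0])
      have e : ‖w‖ • (‖w‖⁻¹ • w) = w := by rw [smul_smul, mul_inv_cancel₀ hw0.ne', one_smul]
      have h3 := (Dj_lim hf h hw0).const_mul (ext g w)
      rw [e, H f hf _ J h] at h3
      convert h3 using 2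
      simp only [ext]
      ring

theorem Rad_adj (k : ℕ) (f g : EuclideanSpace ℝ (Fin (k+2)) → ℝ) (hf : Continuous f) (hg : Continuous g) :
    ∫ ξ : sphere (0 : EuclideanSpace ℝ (Fin (k+2))) 1, g ξ * Rad k f ξ ∂volume.toSphere =
    ∫ ξ : sphere (0 : EuclideanSpace ℝ (Fin (k+2))) 1, f ξ * Rad k g ξ ∂volume.toSphere := by
  obtain ⟨c, hc, H⟩ := adj_lim k
  have h1 := H f g hf hg
  have h2 := H g f hg hf
  simp_rw [Dj_symm hf hg] at h1
  exact mul_left_cancel₀ hc.ne' (tendsto_nhds_unique h1 h2)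

end IB



namespace IB
open Metric SchwartzMap FourierTransform
open scoped ContDiff

/-- hypotheses on the body -/
structure Body {V : Type*} [NormedAddCommGroup V] [InnerProductSpace ℝ V] (K : Set V) (ρ : V → ℝ) : Prop where
  comp : IsCompact K
  star : ∀ x ∈ K, ∀ a : ℝ, a ∈ Icc (0 : ℝ) 1 → a • x ∈ K
  zero : (0 : V) ∈ interior K
  symm : K = -K
  smooth : ContDiffOn ℝ (⊤ : ℕ∞) (gauge K) {(0 : V)}ᶜ
  rho : ∀ x : V, ‖x‖ = 1 → IsGreatest {a : ℝ | 0 < a ∧ a • x ∈ K} (ρ x)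

section body
variable {V : Type*} [NormedAddCommGroup V] [InnerProductSpace ℝ V] {K : Set V} {ρ : V → ℝ}

theorem Body.gauge_unit (hK : Body K ρ) (x : V) (hx : ‖x‖ = 1) : gauge K x = (ρ x)⁻¹ := by
  have h := hK.rho x hx
  have hp := h.1.1
  rw [gauge_def']
  have : {r | r ∈ Ioi (0:ℝ) ∧ r⁻¹ • x ∈ K} = Ici (ρ x)⁻¹ := by
    ext r
    simp only [mem_ofPred_eq, mem_Ioi, mem_Ici]
    constructor
    · rintro ⟨h1, h2⟩
      have := h.2 ⟨inv_pos.2 h1, h2⟩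
      exact inv_le_of_inv_le₀ h1 this
    · intro h1
      have hr : 0 < r := (inv_pos.2 hp).trans_le h1
      refine ⟨hr, ?_⟩
      have := hK.star _ h.1.2 (r⁻¹ * (ρ x)⁻¹) ⟨by positivity, by
        rw [← mul_inv]; exact inv_le_one_of_one_le₀ (by
          rw [inv_le_iff_one_le_mul₀ hp] at h1; linarith)⟩
      rwa [smul_smul, mul_assoc, inv_mul_cancel₀ hp.ne', mul_one] at this
  rw [this, csInf_Ici]

theorem Body.mem_iff (hK : Body K ρ) (x : V) : x ∈ K ↔ gauge K x ≤ 1 := by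
  by_cases hx : x = 0
  · subst hx; simp [interior_subset hK.zero]
  have hn : 0 < ‖x‖ := norm_pos_iff.2 hx
  have hu : ‖‖x‖⁻¹ • x‖ = 1 := by rw [norm_smul]; simp [hx]
  have e : x = ‖x‖ • (‖x‖⁻¹ • x) := by rw [smul_smul, mul_inv_cancel₀ hn.ne', one_smul]
  have h := hK.rho _ hu
  have hp := h.1.1
  have hg : gauge K x = ‖x‖ * (ρ (‖x‖⁻¹ • x))⁻¹ := by
    conv_lhs => rw [e]
    rw [gauge_smul_of_nonneg hn.le, hK.gauge_unit _ hu, smul_eq_mul]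
  rw [hg, mul_inv_le_iff₀ hp, one_mul]
  constructor
  · intro hxK
    exact h.2 ⟨hn, by rwa [← e]⟩
  · intro hle
    have := hK.star _ h.1.2 (‖x‖ * (ρ (‖x‖⁻¹ • x))⁻¹) ⟨by positivity, by
      rw [mul_inv_le_iff₀ hp, one_mul]; exact hle⟩
    rwa [smul_smul, mul_assoc, inv_mul_cancel₀ hp.ne', mul_one, ← e] at this

theorem Body.le_iff (hK : Body K ρ) (x : V) {t : ℝ} (ht : 0 < t) : t⁻¹ • x ∈ K ↔ gauge K x ≤ t := by
  rw [hK.mem_iff, gauge_smul_of_nonneg (inv_pos.2 ht).le, smul_eq_mul, inv_mul_le_iff₀ ht, mul_one]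

theorem Body.gauge_smul (hK : Body K ρ) (x : V) (s : ℝ) : gauge K (s • x) = |s| * gauge K x := by
  have hs : ∀ y ∈ K, -y ∈ K := fun y hy => by
    rw [hK.symm] at hy; exact hy
  rcases le_total 0 s with h | h
  · rw [gauge_smul_of_nonneg h, abs_of_nonneg h, smul_eq_mul]
  · have : s • x = -((-s) • x) := by simp
    rw [this, gauge_neg hs, gauge_smul_of_nonneg (by linarith), abs_of_nonpos h, smul_eq_mul]

theorem Body.bdd (hK : Body K ρ) : ∃ R : ℝ, ∀ (x : V) (t : ℝ), 1 ≤ t → t ≤ 3 → t⁻¹ • x ∈ K → ‖x‖ ≤ R := by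
  obtain ⟨R, hR⟩ := hK.comp.isBounded.exists_norm_le
  refine ⟨3 * R, fun x t h1 h3 hx => ?_⟩
  have := hR _ hx
  have ht : 0 < t := by linarith
  rw [norm_smul, norm_inv, Real.norm_of_nonneg ht.le, inv_mul_le_iff₀ ht] at this
  have h0 := hR 0 (interior_subset hK.zero)
  rw [norm_zero] at h0
  nlinarith

theorem Body.F_smooth (hK : Body K ρ) : ContDiff ℝ ∞ (fun x => phi (gauge K x)) := by
  rw [contDiff_iff_contDiffAt]
  intro x
  by_cases hx : x = 0
  · subst hx
    refine ContDiffAt.congr_of_eventuallyEq (f := fun _ => (0:ℝ)) contDiffAt_const ?_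
    filter_upwards [mem_interior_iff_mem_nhds.1 hK.zero] with y hy
    exact phi_zero (Or.inl ((hK.mem_iff y).1 hy))
  · exact phi_contDiff.contDiffAt.comp x (hK.smooth.contDiffAt (isOpen_compl_singleton.mem_nhds hx))

theorem Body.F_supp [ProperSpace V] (hK : Body K ρ) : HasCompactSupport (fun x => phi (gauge K x)) := by
  obtain ⟨R, hR⟩ := hK.bdd
  refine HasCompactSupport.intro (isCompact_closedBall 0 R) fun x hx => ?_
  apply phi_zero
  by_contra! h
  exact hx (by simpa using hR x 3 (by norm_num) le_rfl ((hK.le_iff x (by norm_num)).2 h.2.le))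

/-- Schwartz function associated with a body -/
noncomputable def Body.F [ProperSpace V] (hK : Body K ρ) : 𝓢(V, ℂ) :=
  HasCompactSupport.toSchwartzMap (f := fun x => ((phi (gauge K x) : ℝ) : ℂ))
    (hK.F_supp.comp_left (g := fun r : ℝ => (r:ℂ)) (by simp))
    (Complex.ofRealCLM.contDiff.comp hK.F_smooth)

theorem Body.F_apply [ProperSpace V] (hK : Body K ρ) (x : V) : hK.F x = phi (gauge K x) := rfl

theorem Body.line_F [ProperSpace V] (hK : Body K ρ) (ξ : V) (hξ : ‖ξ‖ = 1) :
    line 0 hK.F ξ = ρ ξ * ∫ s : ℝ, phi |s| := by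
  have hp := (hK.rho ξ hξ).1.1
  unfold line
  simp only [pow_zero, one_mul, Body.F_apply, hK.gauge_smul, hK.gauge_unit ξ hξ]
  rw [integral_complex_ofReal]
  have := Measure.integral_comp_mul_left (fun s => phi |s|) (ρ ξ)⁻¹
  rw [inv_inv, abs_of_pos hp, smul_eq_mul] at this
  rw [← Complex.ofReal_mul, ← this]
  congr 2; ext s
  rw [abs_mul, abs_of_pos (inv_pos.2 hp), mul_comm]

end body

theorem phi_abs_int : 0 < ∫ s : ℝ, phi |s| := by
  apply Continuous.integral_pos_of_hasCompactSupport_nonneg_nonzero (x := 2)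
  · exact phi_cont.comp continuous_abs
  · refine HasCompactSupport.intro (isCompact_closedBall 0 3) fun x hx => ?_
    simp at hx
    exact phi_zero (Or.inr hx.le)
  · intro r; exact phi_nonneg _
  · simp [phi_two]

theorem phi_layer {s : ℝ} : phi s = - ∫ t in Ioc (1:ℝ) 3, deriv phi t * (if s ≤ t then 1 else 0) := by
  have hd : ∀ t, HasDerivAt phi (deriv phi t) t := fun t =>
    ((phi_contDiff (n := ⊤)).differentiable (by simp)).differentiableAt.hasDerivAt
  have hc : Continuous (deriv phi) := (phi_contDiff (n := ⊤)).continuous_deriv (by simp)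
  have h1 : ∀ a b, ∫ t in a..b, deriv phi t = phi b - phi a := fun a b =>
    intervalIntegral.integral_eq_sub_of_hasDerivAt (fun t _ => hd t) (hc.intervalIntegrable _ _)
  by_cases hs3 : 3 ≤ s
  · rw [phi_zero (Or.inr hs3), setIntegral_eq_zero_of_ae_eq_zero]
    · simp
    have : ∀ᵐ t : ℝ, t ≠ 3 := by simp [ae_iff]
    filter_upwards [this] with t ht hm
    have : ¬ s ≤ t := by
      have := lt_of_le_of_ne hm.2 ht; linarith
    simp [this]
  push Not at hs3
  have e : ∫ t in Ioc (1:ℝ) 3, deriv phi t * (if s ≤ t then 1 else 0) =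
      ∫ t in Ioc (1:ℝ) 3 ∩ Ici s, deriv phi t := by
    rw [← setIntegral_indicator measurableSet_Ici]
    congr 1; ext t
    by_cases h : s ≤ t <;> simp [h, indicator]
  rw [e]
  by_cases hs : s ≤ 1
  · rw [inter_eq_left.2 (fun t ht => by simp at ht ⊢; linarith), ← intervalIntegral.integral_of_le (by norm_num), h1,
      phi_zero (Or.inl hs), phi_zero (t := 3) (by simp), phi_zero (t := 1) (by simp)]
    simp
  · push Not at hs
    have : Ioc (1:ℝ) 3 ∩ Ici s = Icc s 3 := by
      ext t; simp; constructor
      · rintro ⟨⟨_, h⟩, h'⟩; exact ⟨h', h⟩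
      · rintro ⟨h, h'⟩; exact ⟨⟨by linarith, h'⟩, h⟩
    rw [this, integral_Icc_eq_integral_Ioc, ← intervalIntegral.integral_of_le hs3.le, h1, phi_zero (t := 3) (by simp)]
    simp

end IB



namespace IB
open Metric SchwartzMap FourierTransform
open scoped ContDiff

theorem dphi_cont : Continuous (deriv phi) := (phi_contDiff (n := ⊤)).continuous_deriv (by simp)

theorem Body.slice_phi {N : ℕ} {K : Set (EuclideanSpace ℝ (Fin (N+1)))} {ρ} (hK : Body K ρ) {ξ J} (h : Fr ξ J)
    (z : ℝ) :
    ∫ y, phi (gauge K (J y + z • ξ)) = ∫ t in Ioc (1:ℝ) 3, (-(deriv phi t) * t ^ N) *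
      (volume : Measure (EuclideanSpace ℝ (Fin N))).real {y | J y + (t⁻¹ * z) • ξ ∈ K} := by
  have e1 : ∀ y, phi (gauge K (J y + z • ξ)) = ∫ t in Ioc (1:ℝ) 3, -(deriv phi t) *
      K.indicator 1 (t⁻¹ • (J y + z • ξ)) := fun y => by
    rw [phi_layer, ← integral_neg]
    refine setIntegral_congr_fun measurableSet_Ioc fun t ht => ?_
    have ht0 : 0 < t := by linarith [ht.1]
    by_cases hh : t⁻¹ • (J y + z • ξ) ∈ K
    · simp [-smul_add, hh, (hK.le_iff _ ht0).1 hh]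
    · have := (hK.le_iff _ ht0).not.1 hh
      simp [-smul_add, hh, this]
  simp_rw [e1]
  obtain ⟨R, hR⟩ := hK.bdd
  have hmK : MeasurableSet K := hK.comp.isClosed.measurableSet
  have hJm := J.continuous.measurable
  obtain ⟨M, hM⟩ := (isCompact_Icc (a := (1:ℝ)) (b := 3)).exists_bound_of_continuousOn dphi_cont.continuousOn
  have hM0 : 0 ≤ M := (norm_nonneg _).trans (hM 1 (by simp))
  rw [integral_integral_swap]
  · refine setIntegral_congr_fun measurableSet_Ioc fun t ht => ?_
    have ht0 : 0 < t := by linarith [ht.1]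
    rw [integral_const_mul, mul_assoc]
    congr 1
    have e2 : (fun y => K.indicator (1 : EuclideanSpace ℝ (Fin (N+1)) → ℝ) (t⁻¹ • (J y + z • ξ))) =
        ({y | t⁻¹ • (J y + z • ξ) ∈ K}).indicator 1 := by
      ext y; simp [indicator]
    have hms : MeasurableSet {y | t⁻¹ • (J y + z • ξ) ∈ K} := by
      have : Measurable (fun y => t⁻¹ • (J y + z • ξ)) := by fun_prop
      exact this hmK
    rw [e2, integral_indicator_one hms]
    have e3 : {y | t⁻¹ • (J y + z • ξ) ∈ K} = (fun y => t⁻¹ • y) ⁻¹' {y | J y + (t⁻¹ * z) • ξ ∈ K} := by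
      ext y; simp [smul_smul]
    rw [e3, Measure.real, Measure.addHaar_preimage_smul _ (inv_pos.2 ht0).ne', ENNReal.toReal_mul, Measure.real]
    congr 1
    rw [ENNReal.toReal_ofReal (abs_nonneg _)]
    simp [abs_of_pos ht0]
  · have hb : Integrable (fun p : EuclideanSpace ℝ (Fin N) × ℝ => (closedBall (0:EuclideanSpace ℝ (Fin N)) R).indicator (1 : EuclideanSpace ℝ (Fin N) → ℝ) p.1 * M)
        (volume.prod (volume.restrict (Ioc (1:ℝ) 3))) := by
      refine Integrable.mul_prod (f := (closedBall (0:EuclideanSpace ℝ (Fin N)) R).indicator (1 : EuclideanSpace ℝ (Fin N) → ℝ)) (g := fun _ => M) ?_ ?_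
      · rw [integrable_indicator_iff measurableSet_closedBall]
        exact (continuous_const (y := (1:ℝ))).continuousOn.integrableOn_compact (isCompact_closedBall _ _)
      · exact integrable_const _
    refine hb.mono' ?_ ?_
    · have h1 : Measurable (fun p : EuclideanSpace ℝ (Fin N) × ℝ => p.2⁻¹ • (J p.1 + z • ξ)) := by fun_prop
      have h2 := dphi_cont.measurable
      have h3 : Measurable (K.indicator (1 : EuclideanSpace ℝ (Fin (N+1)) → ℝ)) := measurable_one.indicator hmK
      exact Measurable.aestronglyMeasurable
        (((h2.comp measurable_snd).neg).mul (h3.comp h1))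
    · have hae : ∀ᵐ p : EuclideanSpace ℝ (Fin N) × ℝ ∂(volume.prod (volume.restrict (Ioc (1:ℝ) 3))), p.2 ∈ Ioc (1:ℝ) 3 :=
        Measure.quasiMeasurePreserving_snd.ae (ae_restrict_mem measurableSet_Ioc)
      filter_upwards [hae] with p hp
      simp only [Function.uncurry, norm_mul, norm_neg]
      by_cases hh : p.2⁻¹ • (J p.1 + z • ξ) ∈ K
      · have := hR _ _ hp.1.le hp.2 hh
        have h2 : p.1 ∈ closedBall (0:EuclideanSpace ℝ (Fin N)) R := by
          simpa using (h.le_norm p.1 z).trans this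
        simpa [-smul_add, hh, h2] using hM p.2 ⟨hp.1.le, hp.2⟩
      · simp [-smul_add, hh]
        exact mul_nonneg (indicator_nonneg (fun _ _ => zero_le_one) _) hM0

theorem param_step {ε : ℝ} {h : ℝ → ℂ} (hh : ContDiffOn ℝ ∞ h (Ioo (-ε) ε))
    {w : ℝ → ℝ} (hw : ContinuousOn w (Icc 1 3)) {z : ℝ} (hz : z ∈ Ioo (-ε) ε) :
    HasDerivAt (fun z : ℝ => ∫ t in Ioc (1:ℝ) 3, (w t : ℂ) * h (t⁻¹ * z))
      (∫ t in Ioc (1:ℝ) 3, ((w t * t⁻¹ : ℝ) : ℂ) * deriv h (t⁻¹ * z)) z := by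
  have hd : ContinuousOn (deriv h) (Ioo (-ε) ε) := hh.continuousOn_deriv_of_isOpen isOpen_Ioo (by simp)
  have hza : |z| < ε := abs_lt.2 hz
  set δ := (ε + |z|) / 2 with hδ
  have hδε : δ < ε := by linarith
  obtain ⟨M, hM⟩ := (isCompact_Icc (a := -δ) (b := δ)).exists_bound_of_continuousOn
    (hd.mono fun x hx => ⟨by linarith [hx.1], by linarith [hx.2]⟩)
  obtain ⟨W, hW⟩ := (isCompact_Icc (a := (1:ℝ)) (b := 3)).exists_bound_of_continuousOn hw
  have hW0 : 0 ≤ W := (norm_nonneg _).trans (hW 1 (by simp))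
  have hin : ∀ t ∈ Icc (1:ℝ) 3, ∀ x ∈ ball z ((ε - |z|)/2), |t⁻¹ * x| < δ := fun t ht x hx => by
    have h1 : |x| < δ := by
      rw [mem_ball, Real.dist_eq] at hx
      have := abs_sub_abs_le_abs_sub x z
      linarith
    rw [abs_mul]
    refine lt_of_le_of_lt ?_ h1
    rw [abs_of_pos (inv_pos.2 (by linarith [ht.1]))]
    exact mul_le_of_le_one_left (abs_nonneg _) (inv_le_one_of_one_le₀ ht.1)
  have hinv : ContinuousOn (fun t : ℝ => t⁻¹) (Icc 1 3) :=
    continuousOn_inv₀.mono fun t ht => by simp; linarith [ht.1]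
  have hcont : ∀ x ∈ ball z ((ε - |z|)/2), ∀ g : ℝ → ℂ, ContinuousOn g (Ioo (-ε) ε) → ∀ w : ℝ → ℝ,
      ContinuousOn w (Icc 1 3) →
      ContinuousOn (fun t => (w t : ℂ) * g (t⁻¹ * x)) (Icc 1 3) := fun x hx g hg w hw => by
    refine ContinuousOn.mul (Complex.continuous_ofReal.comp_continuousOn hw) ?_
    refine hg.comp (hinv.mul continuousOn_const) fun t ht => ?_
    have := abs_lt.1 (hin t ht x hx)
    exact ⟨by linarith [this.1], by linarith [this.2]⟩
  have hmem : z ∈ ball z ((ε - |z|)/2) := mem_ball_self (by linarith)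
  refine (hasDerivAt_integral_of_dominated_loc_of_deriv_le (bound := fun _ => W * M)
    (F := fun z t => (w t : ℂ) * h (t⁻¹ * z))
    (F' := fun z t => ((w t * t⁻¹ : ℝ) : ℂ) * deriv h (t⁻¹ * z))
    (ball_mem_nhds z (ε := (ε - |z|)/2) (by linarith)) ?_ ?_ ?_ ?_ ?_ ?_).2
  · filter_upwards [ball_mem_nhds z (ε := (ε - |z|)/2) (by linarith)] with x hx
    exact ((hcont x hx h hh.continuousOn w hw).mono Ioc_subset_Icc_self).aestronglyMeasurable measurableSet_Ioc
  · exact ((hcont z hmem h hh.continuousOn w hw).integrableOn_compact isCompact_Icc).mono_set Ioc_subset_Icc_self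
  · exact ((hcont z hmem _ hd _ (hw.mul hinv)).mono Ioc_subset_Icc_self).aestronglyMeasurable measurableSet_Ioc
  · filter_upwards [ae_restrict_mem measurableSet_Ioc] with t ht x hx
    have ht' := Ioc_subset_Icc_self ht
    rw [norm_mul, Complex.norm_real, norm_mul]
    have h1 := hM (t⁻¹ * x) (abs_le.1 (hin t ht' x hx).le)
    have h2 : ‖w t‖ * ‖t⁻¹‖ ≤ W := by
      refine (mul_le_of_le_one_right (norm_nonneg _) ?_).trans (hW t ht')
      rw [norm_inv, Real.norm_of_nonneg (by linarith [ht.1])]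
      exact inv_le_one_of_one_le₀ ht.1.le
    exact mul_le_mul h2 h1 (norm_nonneg _) hW0
  · exact integrable_const _
  · filter_upwards [ae_restrict_mem measurableSet_Ioc] with t ht x hx
    have ht' := Ioc_subset_Icc_self ht
    have h1 := abs_lt.1 (hin t ht' x hx)
    have h2 : HasDerivAt h (deriv h (t⁻¹ * x)) (t⁻¹ * x) :=
      ((hh.differentiableOn (by simp)).differentiableAt (isOpen_Ioo.mem_nhds
        ⟨by linarith [h1.1], by linarith [h1.2]⟩)).hasDerivAt
    have h3 := h2.scomp x ((hasDerivAt_id x).const_mul t⁻¹)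
    have h4 := h3.const_mul (w t : ℂ)
    refine h4.congr_deriv ?_
    simp; ring

theorem param_iter (m : ℕ) : ∀ {ε : ℝ} (_ : 0 < ε) {h : ℝ → ℂ} (_ : ContDiffOn ℝ ∞ h (Ioo (-ε) ε))
    {w : ℝ → ℝ} (_ : ContinuousOn w (Icc 1 3)),
    iteratedDeriv m (fun z : ℝ => ∫ t in Ioc (1:ℝ) 3, (w t : ℂ) * h (t⁻¹ * z)) 0 =
      ((∫ t in Ioc (1:ℝ) 3, w t * (t⁻¹) ^ m : ℝ) : ℂ) * iteratedDeriv m h 0 := by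
  induction m with
  | zero =>
    intro ε hε h hh w hw
    simp only [iteratedDeriv_zero, mul_zero, pow_zero, mul_one]
    rw [integral_mul_const, integral_complex_ofReal]
  | succ m ih =>
    intro ε hε h hh w hw
    rw [iteratedDeriv_succ', iteratedDeriv_succ']
    have hinv : ContinuousOn (fun t : ℝ => t⁻¹) (Icc 1 3) :=
      continuousOn_inv₀.mono fun t ht => by simp; linarith [ht.1]
    have := ih hε (h := deriv h) (hh.deriv_of_isOpen isOpen_Ioo (by simp)) (w := fun t => w t * t⁻¹) (hw.mul hinv)
    have e : ∀ t : ℝ, w t * t⁻¹ ^ (m + 1) = w t * t⁻¹ * t⁻¹ ^ m := fun t => by ring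
    simp_rw [e]
    rw [← this]
    refine Filter.EventuallyEq.iteratedDeriv_eq _ ?_
    filter_upwards [Ioo_mem_nhds (neg_lt_zero.2 hε) hε] with z hz
    exact (param_step hh hw hz).deriv

theorem iteratedDeriv_ofReal (m : ℕ) {h : ℝ → ℝ} (hh : ContDiffAt ℝ ∞ h 0) :
    iteratedDeriv m (fun z => (h z : ℂ)) 0 = ((iteratedDeriv m h 0 : ℝ) : ℂ) := by
  have := Complex.ofRealCLM.iteratedFDeriv_comp_left (n := ∞) hh (i := m) (by exact_mod_cast le_top)
  simp only [iteratedDeriv_eq_iteratedFDeriv]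
  have e : (fun z => (h z : ℂ)) = Complex.ofRealCLM ∘ h := rfl
  rw [e, this]
  rfl

theorem phi_tint : ∫ t in Ioc (1:ℝ) 3, -(deriv phi t) * t = ∫ t, phi t := by
  rw [← intervalIntegral.integral_of_le (by norm_num)]
  have hd : ∀ t, HasDerivAt phi (deriv phi t) t := fun t =>
    ((phi_contDiff (n := ⊤)).differentiable (by simp)).differentiableAt.hasDerivAt
  have h := intervalIntegral.integral_mul_deriv_eq_deriv_mul (a := (1:ℝ)) (b := 3) (u := fun t => t) (v := phi)
    (u' := fun _ => 1) (v' := deriv phi)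
    (fun t _ => hasDerivAt_id t) (fun t _ => hd t) (by simp) (dphi_cont.intervalIntegrable _ _)
  rw [phi_zero (t := 3) (by simp), phi_zero (t := 1) (by simp)] at h
  have e : ∀ t, -(deriv phi t) * t = -(t * deriv phi t) := fun t => by ring
  simp_rw [e]
  rw [intervalIntegral.integral_neg, h]
  simp only [one_mul, mul_zero, sub_zero, zero_sub, neg_neg]
  rw [intervalIntegral.integral_of_le (by norm_num), setIntegral_eq_integral_of_forall_compl_eq_zero]
  intro t ht
  simp at ht
  by_cases h1 : t ≤ 1
  · exact phi_zero (Or.inl h1)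
  · exact phi_zero (Or.inr (ht (by linarith)).le)

theorem Body.link (k : ℕ) (hk : Even k) : ∃ C : ℝ, 0 < C ∧ ∀ {K : Set (EuclideanSpace ℝ (Fin (k+2)))} {ρ}
    (hK : Body K ρ) (A : EuclideanSpace ℝ (Fin (k+2)) → ℝ → ℝ)
    (_ : ∀ ξ, ‖ξ‖ = 1 → ∀ z : ℝ,
      A ξ z = (μH[((k+1 : ℕ) : ℝ)] (K ∩ {x | ⟪x, ξ⟫ = z})).toReal)
    (_ : ∀ ξ, ‖ξ‖ = 1 → ∃ ε > (0 : ℝ), ContDiffOn ℝ ∞ (A ξ) (Ioo (-ε) ε)),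
    ∀ ξ, ‖ξ‖ = 1 → (((-1 : ℝ) ^ (k / 2) * iteratedDeriv k (A ξ) 0 : ℝ) : ℂ) =
      C * line k (𝓕 hK.F : 𝓢(_, ℂ)) ξ := by
  obtain ⟨c, hc, H⟩ := section_param (k+1)
  refine ⟨c * (2 * Real.pi) ^ k / ∫ t, phi t, div_pos (mul_pos hc (by positivity)) phi_int,
    fun {K ρ} hK A hA hAs ξ hξ => ?_⟩
  obtain ⟨J, h⟩ := exists_fr ξ hξ
  obtain ⟨ε, hε, hs⟩ := hAs ξ hξ
  have h1 := slice k hk hK.F h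
  have hAt : ∀ z, (volume : Measure (EuclideanSpace ℝ (Fin (k+1)))).real {y | J y + z • ξ ∈ K} = c⁻¹ * A ξ z := fun z => by
    rw [hA ξ hξ, H ξ J h, inv_mul_cancel_left₀ hc.ne']
  have e1 : (fun z : ℝ => ∫ y, hK.F (J y + z • ξ)) = fun z : ℝ => ∫ t in Ioc (1:ℝ) 3,
      (((-(deriv phi t) * t ^ (k+1)) * c⁻¹ : ℝ) : ℂ) * (A ξ (t⁻¹ * z) : ℂ) := by
    ext z
    simp only [Body.F_apply]
    rw [integral_complex_ofReal, hK.slice_phi h z, ← integral_complex_ofReal]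
    congr 1; ext t
    rw [hAt]; push_cast; ring
  rw [e1, param_iter k hε (h := fun z => (A ξ z : ℂ)) (Complex.ofRealCLM.contDiff.comp_contDiffOn hs)
    (w := fun t => (-(deriv phi t) * t ^ (k+1)) * c⁻¹)
    (Continuous.continuousOn (by have := dphi_cont; fun_prop)),
    iteratedDeriv_ofReal k (hs.contDiffAt (Ioo_mem_nhds (neg_lt_zero.2 hε) hε))] at h1
  have e2 : ∫ t in Ioc (1:ℝ) 3, (-(deriv phi t) * t ^ (k+1)) * c⁻¹ * t⁻¹ ^ k = c⁻¹ * ∫ t, phi t := by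
    rw [← phi_tint, ← integral_const_mul]
    refine setIntegral_congr_fun measurableSet_Ioc fun t ht => ?_
    have ht0 : t ≠ 0 := by linarith [ht.1]
    rw [pow_succ, inv_pow]
    field_simp
  rw [e2] at h1
  have hp : ((∫ t, phi t : ℝ) : ℂ) ≠ 0 := by exact_mod_cast phi_int.ne'
  have hcc : (c : ℂ) ≠ 0 := by exact_mod_cast hc.ne'
  have hs2 : ((-1 : ℂ) ^ (k/2)) * (-1) ^ (k/2) = 1 := by rw [← mul_pow]; simp
  push_cast at h1 ⊢
  have h2 : ((iteratedDeriv k (A ξ) 0 : ℝ) : ℂ) * ∫ t, ((phi t : ℝ) : ℂ) =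
      c * ((2 * Real.pi) ^ k * (-1) ^ (k / 2) * line k (𝓕 hK.F : 𝓢(_, ℂ)) ξ) := by
    rw [← h1]; rw [integral_complex_ofReal]; field_simp
  rw [integral_complex_ofReal] at h2
  field_simp
  linear_combination (-1 : ℂ) ^ (k/2) * h2 + c * (2 * Real.pi) ^ k * line k (𝓕 hK.F : 𝓢(_, ℂ)) ξ * hs2

end IB



namespace IB
open Metric SchwartzMap FourierTransform
open scoped ContDiff

theorem tietze {V : Type*} [NormedAddCommGroup V] {g : V → ℝ} (hg : ContinuousOn g (sphere 0 1)) :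
    ∃ g' : V → ℝ, Continuous g' ∧ ∀ x, ‖x‖ = 1 → g' x = g x := by
  obtain ⟨G, hG⟩ := ContinuousMap.exists_restrict_eq (isClosed_sphere (x := (0:V)) (ε := 1))
    ⟨(sphere (0:V) 1).restrict g, hg.restrict⟩
  refine ⟨G, G.continuous, fun x hx => ?_⟩
  have := DFunLike.congr_fun hG ⟨x, by simpa using hx⟩
  exact this

theorem RadG (k : ℕ) (hk : Even k) : ∃ c : ℝ, 0 < c ∧ ∀ Φ : 𝓢(EuclideanSpace ℝ (Fin (k+2)), ℂ),
    ∃ g : EuclideanSpace ℝ (Fin (k+2)) → ℝ, Continuous g ∧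
    (∀ ξ, ‖ξ‖ = 1 → g ξ = (line k (𝓕 Φ : 𝓢(_, ℂ)) ξ).re) ∧
    ∀ ξ, ‖ξ‖ = 1 → Rad k g ξ = c * (line 0 Φ ξ).re := by
  obtain ⟨c, hc, H⟩ := radon_param k
  refine ⟨c * 2, by positivity, fun Φ => ?_⟩
  obtain ⟨g, hg, hgl⟩ := tietze (Complex.continuous_re.comp_continuousOn (line_cont k (𝓕 Φ : 𝓢(_, ℂ))))
  refine ⟨g, hg, hgl, fun ξ hξ => ?_⟩
  obtain ⟨J, h⟩ := exists_fr ξ hξ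
  unfold Rad
  rw [H ξ J h g hg.continuousOn, mul_assoc]
  congr 1
  have h1 := congrArg Complex.re (radon_line k hk Φ h)
  have h2 : Continuous (fun θ : sphere (0 : EuclideanSpace ℝ (Fin (k+1))) 1 =>
      line k (𝓕 Φ : 𝓢(_, ℂ)) (J θ)) :=
    (line_cont k (𝓕 Φ : 𝓢(_, ℂ))).comp_continuous (J.continuous.comp continuous_subtype_val) (fun θ => by simp)
  have h3 : Integrable (fun θ : sphere (0 : EuclideanSpace ℝ (Fin (k+1))) 1 =>
      line k (𝓕 Φ : 𝓢(_, ℂ)) (J θ)) (volume : Measure (EuclideanSpace ℝ (Fin (k+1)))).toSphere :=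
    h2.integrable_of_hasCompactSupport (HasCompactSupport.of_compactSpace _)
  have h4 := Complex.reCLM.integral_comp_comm h3
  simp only [Complex.reCLM_apply] at h4
  rw [← h4] at h1
  simp only [Complex.mul_re, Complex.re_ofNat, Complex.im_ofNat, zero_mul, sub_zero] at h1
  rw [← h1]
  congr 1; ext θ
  exact hgl _ (by simp)

theorem key_identity (k : ℕ) (hk : Even k) {K : Set (EuclideanSpace ℝ (Fin (k+2)))} {ρ}
    (hK : Body K ρ) :
    ∃ b : ℝ, 0 < b ∧ ∃ g : EuclideanSpace ℝ (Fin (k+2)) → ℝ, Continuous g ∧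
    (∀ ξ, ‖ξ‖ = 1 → g ξ = (line k (𝓕 hK.F : 𝓢(_, ℂ)) ξ).re) ∧
    ∀ f : EuclideanSpace ℝ (Fin (k+2)) → ℝ, Continuous f →
      ∫ x in sphere (0 : EuclideanSpace ℝ (Fin (k+2))) 1, ρ x * f x ∂μH[((k+1 : ℕ) : ℝ)] =
      b * ∫ ξ : sphere (0 : EuclideanSpace ℝ (Fin (k+2))) 1, g ξ * Rad k f ξ ∂volume.toSphere := by
  obtain ⟨c, hc, H⟩ := RadG k hk
  obtain ⟨g, hg, hgl, hR⟩ := H hK.F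
  obtain ⟨c0, hc0, H0⟩ := sphere_hausdorff (V := EuclideanSpace ℝ (Fin (k+2))) (k+1) (by simp)
  have hP := phi_abs_int
  have hrho : ∀ ξ, ‖ξ‖ = 1 → ρ ξ = (line 0 hK.F ξ).re * (∫ s : ℝ, phi |s|)⁻¹ := fun ξ hξ => by
    rw [hK.line_F ξ hξ, ← Complex.ofReal_mul, Complex.ofReal_re, mul_assoc, mul_inv_cancel₀ hP.ne', mul_one]
  have hrc : ContinuousOn ρ (sphere 0 1) := by
    refine ((Complex.continuous_re.comp_continuousOn (line_cont 0 hK.F)).mul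
      (continuousOn_const (c := (∫ s : ℝ, phi |s|)⁻¹))).congr fun ξ hξ => ?_
    exact hrho ξ (by simpa using hξ)
  refine ⟨c0 * (c * ∫ s : ℝ, phi |s|)⁻¹, by positivity, g, hg, hgl, fun f hf => ?_⟩
  rw [H0 (fun x => ρ x * f x) (hrc.mul hf.continuousOn), mul_assoc]
  congr 1
  rw [Rad_adj k f g hf hg, eq_inv_mul_iff_mul_eq₀ (by positivity), ← integral_const_mul]
  congr 1; ext ξ
  have hξ : ‖ξ.1‖ = 1 := by simp
  rw [hR _ hξ, hrho _ hξ]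
  field_simp

theorem sphere_cases {V : Type*} [NormedAddCommGroup V] [NormedSpace ℝ V] {ξ ξ0 : V} (h : ‖ξ‖ = 1) (h0 : ‖ξ0‖ = 1)
    {s δ : ℝ} (hδ : δ < 1) (hs : ‖s • ξ - ξ0‖ < δ) : ‖ξ - ξ0‖ < 2 * δ ∨ ‖-ξ - ξ0‖ < 2 * δ := by
  have h1 : |‖s • ξ‖ - ‖ξ0‖| < δ := (abs_norm_sub_norm_le _ _).trans_lt hs
  rw [norm_smul, h, h0, mul_one, Real.norm_eq_abs] at h1
  rcases le_total 0 s with hs0 | hs0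
  · left
    rw [abs_of_nonneg hs0] at h1
    have : ξ - ξ0 = (1 - s) • ξ + (s • ξ - ξ0) := by rw [sub_smul, one_smul]; abel
    rw [this]
    refine (norm_add_le _ _).trans_lt ?_
    rw [norm_smul, h, mul_one, Real.norm_eq_abs, abs_sub_comm]
    linarith
  · right
    rw [abs_of_nonpos hs0] at h1
    have : -ξ - ξ0 = (-1 - s) • ξ + (s • ξ - ξ0) := by rw [sub_smul, neg_smul, one_smul]; abel
    rw [this]
    refine (norm_add_le _ _).trans_lt ?_
    rw [norm_smul, h, mul_one, Real.norm_eq_abs, show -1 - s = -s - 1 by ring]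
    linarith

theorem bump_test {V : Type*} [NormedAddCommGroup V] [InnerProductSpace ℝ V] [FiniteDimensional ℝ V]
    (ξ0 : V) (h0 : ‖ξ0‖ = 1) {r : ℝ} (hr : 0 < r) : ∃ Φ : 𝓢(V, ℂ),
    (∀ ξ, 0 ≤ (line 0 Φ ξ).re) ∧ 0 < (line 0 Φ ξ0).re ∧
    ∀ ξ, ‖ξ‖ = 1 → (line 0 Φ ξ).re ≠ 0 → ‖ξ - ξ0‖ < r ∨ ‖-ξ - ξ0‖ < r := by
  have : ProperSpace V := FiniteDimensional.proper ℝ V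
  let δ := min (r / 2) (1 / 2)
  have hδ : 0 < δ := by positivity
  have hδ1 : δ ≤ 1 / 2 := min_le_right _ _
  have hδr : δ ≤ r / 2 := min_le_left _ _
  let B : ContDiffBump ξ0 := ⟨δ / 2, δ, by positivity, by linarith⟩
  have hB0 : ∀ x, δ ≤ ‖x - ξ0‖ → B x = 0 := fun x hx => B.zero_of_le_dist (by rw [dist_eq_norm]; exact hx)
  let Φ : 𝓢(V, ℂ) := HasCompactSupport.toSchwartzMap (f := fun x => ((B x : ℝ) : ℂ))
    (B.hasCompactSupport.comp_left (g := fun r : ℝ => (r:ℂ)) (by simp))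
    (Complex.ofRealCLM.contDiff.comp B.contDiff)
  have hΦ : ∀ x, Φ x = ((B x : ℝ) : ℂ) := fun x => rfl
  have hl : ∀ ξ, (line 0 Φ ξ).re = ∫ s : ℝ, B (s • ξ) := fun ξ => by
    unfold line
    simp only [pow_zero, one_mul, hΦ]
    rw [integral_complex_ofReal, Complex.ofReal_re]
  have hBn : ∀ x, 0 ≤ B x := fun x => B.nonneg
  refine ⟨Φ, fun ξ => ?_, ?_, fun ξ hξ hne => ?_⟩
  · rw [hl]; exact integral_nonneg fun s => hBn _
  · rw [hl]
    have hBc := B.continuous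
    apply Continuous.integral_pos_of_hasCompactSupport_nonneg_nonzero (x := 1)
    · exact hBc.comp (by fun_prop)
    · refine HasCompactSupport.intro (isCompact_closedBall 0 3) fun s hs => hB0 _ ?_
      simp at hs
      have : |‖s • ξ0‖ - ‖ξ0‖| ≤ ‖s • ξ0 - ξ0‖ := abs_norm_sub_norm_le _ _
      rw [norm_smul, h0, mul_one, Real.norm_eq_abs] at this
      have := (le_abs_self _).trans this
      linarith
    · intro s; exact hBn _
    · have : B ξ0 = 1 := B.one_of_mem_closedBall (by simp; exact B.rIn_pos.le)
      simp [this]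
  · rw [hl] at hne
    by_contra! hcon
    apply hne
    have : ∀ s : ℝ, B (s • ξ) = 0 := fun s => by
      apply hB0
      by_contra! hlt
      rcases sphere_cases hξ h0 (by linarith) hlt with h | h
      · linarith [hcon.1]
      · linarith [hcon.2]
    simp [this]

theorem main_k (k : ℕ) (hk : Even k) {K : Set (EuclideanSpace ℝ (Fin (k+2)))} {ρ}
    (hK : Body K ρ) (A : EuclideanSpace ℝ (Fin (k+2)) → ℝ → ℝ)
    (hA : ∀ ξ, ‖ξ‖ = 1 → ∀ z : ℝ,
      A ξ z = (μH[((k+1 : ℕ) : ℝ)] (K ∩ {x | ⟪x, ξ⟫ = z})).toReal)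
    (hAs : ∀ ξ, ‖ξ‖ = 1 → ∃ ε > (0 : ℝ), ContDiffOn ℝ ∞ (A ξ) (Ioo (-ε) ε)) :
    (∃ μ : Measure (sphere (0 : EuclideanSpace ℝ (Fin (k+2))) 1), IsFiniteMeasure μ ∧
      ∀ f : EuclideanSpace ℝ (Fin (k+2)) → ℝ, Continuous f →
        ∫ x in sphere (0 : EuclideanSpace ℝ (Fin (k+2))) 1, ρ x * f x ∂μH[((k+1 : ℕ) : ℝ)]
          = ∫ ξ : sphere (0 : EuclideanSpace ℝ (Fin (k+2))) 1, Rad k f ξ ∂μ)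
    ↔ ∀ ξ : EuclideanSpace ℝ (Fin (k+2)), ‖ξ‖ = 1 →
        0 ≤ (-1 : ℝ) ^ (k / 2) * iteratedDeriv k (A ξ) 0 := by
  obtain ⟨C, hC, hlink⟩ := Body.link k hk
  obtain ⟨b, hb, g, hg, hgl, hkey⟩ := key_identity k hk hK
  have hAg : ∀ ξ, ‖ξ‖ = 1 → (-1 : ℝ) ^ (k / 2) * iteratedDeriv k (A ξ) 0 = C * g ξ := fun ξ hξ => by
    have := congrArg Complex.re (hlink hK A hA hAs ξ hξ)
    rw [Complex.ofReal_re, Complex.re_ofReal_mul, ← hgl ξ hξ] at this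
    exact this
  constructor
  · rintro ⟨μ, hμ, hf⟩ ξ0 h0
    rw [hAg ξ0 h0]
    by_contra! hneg
    have hg0 : g ξ0 < 0 := by
      by_contra! h; exact absurd hneg (not_lt.2 (by positivity))
    obtain ⟨r, hr, hball⟩ := Metric.eventually_nhds_iff.1 ((hg.tendsto ξ0).eventually_lt_const hg0)
    obtain ⟨Φ, p1, p2, p3⟩ := bump_test ξ0 h0 hr
    have hle : ∀ ξ, ‖ξ‖ = 1 → g ξ * (line 0 Φ ξ).re ≤ 0 := fun ξ hξ => by
      by_cases hz : (line 0 Φ ξ).re = 0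
      · simp [hz]
      · refine mul_nonpos_of_nonpos_of_nonneg ?_ (p1 ξ)
        rcases p3 ξ hξ hz with h | h
        · exact (hball (by rwa [dist_eq_norm])).le
        · have h1 : g (-ξ) < 0 := hball (by rwa [dist_eq_norm])
          rw [hgl _ (by simpa using hξ), line_neg k hk, ← hgl ξ hξ] at h1
          exact h1.le
    obtain ⟨c, hc, H⟩ := RadG k hk
    obtain ⟨q, hq, -, hqR⟩ := H Φ
    have h1 := hf q hq
    rw [hkey q hq] at h1
    have hpos : 0 ≤ ∫ ξ : sphere (0 : EuclideanSpace ℝ (Fin (k+2))) 1, Rad k q ξ ∂μ :=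
      integral_nonneg fun ξ => by
        change 0 ≤ Rad k q ξ
        rw [hqR _ (by simp)]; exact mul_nonneg hc.le (p1 _)
    rw [← h1] at hpos
    have e : ∀ ξ : sphere (0 : EuclideanSpace ℝ (Fin (k+2))) 1, g ξ * Rad k q ξ =
        -(c * (-(g ξ * (line 0 Φ ξ.1).re))) := fun ξ => by rw [hqR _ (by simp)]; ring
    simp_rw [e] at hpos
    rw [integral_neg, integral_const_mul] at hpos
    have hlt : 0 < ∫ ξ : sphere (0 : EuclideanSpace ℝ (Fin (k+2))) 1, -(g ξ * (line 0 Φ ξ.1).re)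
        ∂(volume : Measure (EuclideanSpace ℝ (Fin (k+2)))).toSphere := by
      apply Continuous.integral_pos_of_hasCompactSupport_nonneg_nonzero (x := ⟨ξ0, by simpa using h0⟩)
      · refine ((hg.comp continuous_subtype_val).mul ?_).neg
        exact Complex.continuous_re.comp ((line_cont 0 Φ).comp_continuous continuous_subtype_val (fun θ => θ.2))
      · exact HasCompactSupport.of_compactSpace _
      · intro ξ
        have := hle ξ.1 (by simp)
        simpa using this
      · have := mul_neg_of_neg_of_pos hg0 p2
        simpa using ⟨hg0.ne, p2.ne'⟩
    have : 0 < b * (c * ∫ ξ : sphere (0 : EuclideanSpace ℝ (Fin (k+2))) 1, -(g ξ * (line 0 Φ ξ.1).re)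
        ∂(volume : Measure (EuclideanSpace ℝ (Fin (k+2)))).toSphere) := mul_pos hb (mul_pos hc hlt)
    linarith
  · intro hall
    have hg0 : ∀ ξ, ‖ξ‖ = 1 → 0 ≤ g ξ := fun ξ hξ => by
      have := hall ξ hξ
      rw [hAg ξ hξ] at this
      exact nonneg_of_mul_nonneg_right this hC
    have hcont : Continuous (fun ξ : sphere (0 : EuclideanSpace ℝ (Fin (k+2))) 1 => b * g ξ) :=
      (hg.comp continuous_subtype_val).const_mul b
    refine ⟨(volume : Measure (EuclideanSpace ℝ (Fin (k+2)))).toSphere.withDensity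
      (fun ξ => ((b * g ξ).toNNReal : ℝ≥0∞)), ?_, fun f hf => ?_⟩
    · exact isFiniteMeasure_withDensity_ofReal
        (hcont.integrable_of_hasCompactSupport (HasCompactSupport.of_compactSpace _)).2
    · rw [hkey f hf, integral_withDensity_eq_integral_smul hcont.measurable.real_toNNReal,
        ← integral_const_mul]
      congr 1; ext ξ
      have := hg0 ξ.1 (by simp)
      rw [NNReal.smul_def, Real.coe_toNNReal _ (by positivity), smul_eq_mul, mul_assoc]

end IB


/-- Characterization of smooth intersection bodies in even dimension: for `n ≥ 2` even
and an origin-symmetric star body `K` in `ℝⁿ` with `C^∞` boundary, `K` is an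
intersection body if and only if `(−1)^{(n−2)/2} A_ξ^{(n−2)}(0) ≥ 0` for every unit
vector `ξ`, where `A_ξ(z) = vol_{n−1}(K ∩ {x : ⟨x,ξ⟩ = z})` is the parallel section
function. -/
theorem intersection_body_iff_sign_of_derivative (n : ℕ) (hn : 2 ≤ n) (hneven : Even n)
    (K : Set (EuclideanSpace ℝ (Fin n)))
    (hKcomp : IsCompact K)
    (hKstar : ∀ x ∈ K, ∀ a : ℝ, a ∈ Icc (0 : ℝ) 1 → a • x ∈ K)
    (hK0 : (0 : EuclideanSpace ℝ (Fin n)) ∈ interior K)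
    (hKsymm : K = -K)
    (hKsmooth : ContDiffOn ℝ (⊤ : ℕ∞) (gauge K) {(0 : EuclideanSpace ℝ (Fin n))}ᶜ)
    (ρ : EuclideanSpace ℝ (Fin n) → ℝ)
    (hρ : ∀ x : EuclideanSpace ℝ (Fin n), ‖x‖ = 1 →
      IsGreatest {a : ℝ | 0 < a ∧ a • x ∈ K} (ρ x))
    (A : EuclideanSpace ℝ (Fin n) → ℝ → ℝ)
    (hA : ∀ ξ : EuclideanSpace ℝ (Fin n), ‖ξ‖ = 1 → ∀ z : ℝ,
      A ξ z = (μH[(n : ℝ) - 1]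
        (K ∩ {x : EuclideanSpace ℝ (Fin n) | ⟪x, ξ⟫ = z})).toReal)
    (hAsmooth : ∀ ξ : EuclideanSpace ℝ (Fin n), ‖ξ‖ = 1 →
      ∃ ε > (0 : ℝ), ContDiffOn ℝ (⊤ : ℕ∞) (A ξ) (Ioo (-ε) ε)) :
    (∃ μ : Measure (Metric.sphere (0 : EuclideanSpace ℝ (Fin n)) 1),
      IsFiniteMeasure μ ∧
      ∀ f : EuclideanSpace ℝ (Fin n) → ℝ, Continuous f →
        ∫ x in Metric.sphere (0 : EuclideanSpace ℝ (Fin n)) 1, ρ x * f x ∂μH[(n : ℝ) - 1]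
          = ∫ ξ : Metric.sphere (0 : EuclideanSpace ℝ (Fin n)) 1,
              (∫ x in Metric.sphere (0 : EuclideanSpace ℝ (Fin n)) 1 ∩
                  {x : EuclideanSpace ℝ (Fin n) |
                    ⟪x, (ξ : EuclideanSpace ℝ (Fin n))⟫ = 0},
                f x ∂μH[(n : ℝ) - 2]) ∂μ)
    ↔ ∀ ξ : EuclideanSpace ℝ (Fin n), ‖ξ‖ = 1 →
        0 ≤ (-1 : ℝ) ^ ((n - 2) / 2) * iteratedDeriv (n - 2) (A ξ) 0 := by
  obtain ⟨k, rfl⟩ : ∃ k, n = k + 2 := ⟨n - 2, by omega⟩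
  have hk : Even k := by
    rw [Nat.even_iff] at hneven ⊢
    omega
  have e1 : ((k + 2 : ℕ) : ℝ) - 1 = ((k + 1 : ℕ) : ℝ) := by push_cast; ring
  have e2 : ((k + 2 : ℕ) : ℝ) - 2 = (k : ℝ) := by push_cast; ring
  rw [e1] at hA
  rw [e1, e2]
  exact IB.main_k k hk (⟨hKcomp, hKstar, hK0, hKsymm, hKsmooth, hρ⟩ : IB.Body K ρ) A hA hAsmooth
end

section
/- Let k be an odd positive integer. Then the function q ↦ Γ(−q) · sin(π(q+1)/2) of a real variable q tends to (−1)^{(k+1)/2} · π / (2 · k!) as q → k with q ≠ k; that is, lim_{q→k, q≠k} Γ(−q) sin((q+1)π/2) = (−1)^{(k+1)/2} π / (2 k!). -/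
open Filter
open scoped Real Topology

/-- For an odd positive integer `k`,
`lim_{q→k, q≠k} Γ(−q) sin((q+1)π/2) = (−1)^{(k+1)/2} π / (2 k!)`. -/
theorem gamma_sin_limit (k : ℕ) (hk : Odd k) (hkpos : 0 < k) :
    Tendsto (fun q : ℝ => Real.Gamma (-q) * Real.sin ((q + 1) * π / 2))
      (𝓝[≠] (k : ℝ))
      (𝓝 ((-1 : ℝ) ^ ((k + 1) / 2) * π / (2 * (Nat.factorial k)))) := by
  obtain ⟨m, rfl⟩ := hk
  have hs : Real.sin (π * ((2 * m + 1 : ℕ) : ℝ) / 2) = (-1) ^ m := by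
    have : π * ((2 * m + 1 : ℕ) : ℝ) / 2 = π / 2 + m * π := by push_cast; ring
    rw [this, Real.sin_add_nat_mul_pi, Real.sin_pi_div_two, mul_one]
  have hG : Real.Gamma (((2 * m + 1 : ℕ) : ℝ) + 1) = (Nat.factorial (2 * m + 1) : ℝ) :=
    Real.Gamma_nat_eq_factorial _
  have hf : (Nat.factorial (2 * m + 1) : ℝ) ≠ 0 := by positivity
  have hc : ContinuousAt (fun q : ℝ => -π / (2 * Real.sin (π * q / 2) * Real.Gamma (q + 1)))
      ((2 * m + 1 : ℕ) : ℝ) := by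
    have h1 : ContinuousAt (fun q : ℝ => Real.Gamma (q + 1)) ((2 * m + 1 : ℕ) : ℝ) := by
      refine ContinuousAt.comp (g := Real.Gamma) (f := fun q : ℝ => q + 1) ?_ (by fun_prop)
      refine (Real.differentiableAt_Gamma fun n => ?_).continuousAt
      have : (0 : ℝ) ≤ n := n.cast_nonneg
      have h2 : (0 : ℝ) ≤ ((2 * m + 1 : ℕ) : ℝ) := Nat.cast_nonneg _
      intro h
      linarith
    refine ContinuousAt.div continuousAt_const (ContinuousAt.mul (by fun_prop) h1) ?_
    rw [hs, hG]
    exact mul_ne_zero (mul_ne_zero two_ne_zero (pow_ne_zero _ (by norm_num))) hf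
  have hv : (-1 : ℝ) ^ ((2 * m + 1 + 1) / 2) * π / (2 * (Nat.factorial (2 * m + 1)))
      = -π / (2 * Real.sin (π * ((2 * m + 1 : ℕ) : ℝ) / 2) *
        Real.Gamma (((2 * m + 1 : ℕ) : ℝ) + 1)) := by
    rw [hs, hG, show (2 * m + 1 + 1) / 2 = m + 1 by omega, pow_succ]
    rcases neg_one_pow_eq_or ℝ m with h | h <;> rw [h] <;> field_simp
  rw [hv]
  refine (hc.tendsto.mono_left nhdsWithin_le_nhds).congr' ?_
  have hball : ∀ᶠ q in 𝓝[≠] ((2 * m + 1 : ℕ) : ℝ), q ∈ Metric.ball ((2 * m + 1 : ℕ) : ℝ) 1 :=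
    nhdsWithin_le_nhds (Metric.ball_mem_nhds _ one_pos)
  filter_upwards [hball, self_mem_nhdsWithin] with q hq hne
  have hcos : Real.cos (π * q / 2) ≠ 0 := by
    intro h
    obtain ⟨n, hn⟩ := Real.cos_eq_zero_iff.1 h
    have hqn : q = ((2 * n + 1 : ℤ) : ℝ) := by
      push_cast
      have := Real.pi_pos
      apply mul_left_cancel₀ this.ne'
      linarith
    rw [Metric.mem_ball, Real.dist_eq, abs_lt, hqn] at hq
    have h1 : (-1 : ℤ) < (2 * n + 1) - (2 * m + 1) := by exact_mod_cast hq.1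
    have h2 : (2 * n + 1) - (2 * m + 1) < (1 : ℤ) := by exact_mod_cast hq.2
    apply hne
    have : n = m := by omega
    rw [Set.mem_singleton_iff, hqn, this]
    push_cast
    ring
  have hq0 : 0 < q := by
    rw [Metric.mem_ball, Real.dist_eq, abs_lt] at hq
    have : (0 : ℝ) ≤ m := m.cast_nonneg
    have := hq.1
    push_cast at this
    linarith
  have hGq : Real.Gamma (q + 1) ≠ 0 := (Real.Gamma_pos_of_pos (by linarith)).ne'
  have hr := Real.Gamma_mul_Gamma_one_sub (-q)
  rw [show 1 - -q = q + 1 by ring, show π * -q = -(2 * (π * q / 2)) by ring, Real.sin_neg,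
    Real.sin_two_mul] at hr
  rw [show (q + 1) * π / 2 = π * q / 2 + π / 2 by ring, Real.sin_add_pi_div_two,
    eq_div_of_mul_eq hGq hr]
  by_cases hs0 : Real.sin (π * q / 2) = 0
  · simp [hs0]
  · field_simp
end
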